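/- Let 1≤κ≤2 and μ>0. Then there exists a constant C>0, depending only on κ and μ, such that the following holds: if φ,ψ:ℝ³→ℝ are smooth and u* is a smooth solution of ∂_t²u*−Δ_x u*=0 on (0,∞)×ℝ³ with u*(0,·)=φ and ∂_t u*(0,·)=ψ, then for every t>0, every r≥1, and every unit vector ω∈S², setting v*(t,r,ω)=r·u*(t,rω), one has |(∂_t+∂_r)v*(t,r,ω)| ≤ C·⟨t+r⟩^{−κ}·B_{κ+μ+1,2}[φ,ψ;1](t,rω), where ∂_r on the left denotes differentiation of v* in the radial variable r. -/

import Mathlib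

noncomputable section

namespace PaperKatayama

/-- Euclidean 3-space. -/
abbrev E3 := EuclideanSpace ℝ (Fin 3)

/-- Space-time functions. -/
abbrev Fn := ℝ → E3 → ℝ

/-- Functions of the space variable alone. -/
abbrev SFn := E3 → ℝ

/-- The Japanese bracket `⟨a⟩ = √(1+a²)`. -/
def jb (a : ℝ) : ℝ := Real.sqrt (1 + a ^ 2)

/-- Time derivative `∂_t`. -/
def pt (f : Fn) : Fn := fun t x => deriv (fun s => f s x) t

/-- Spatial derivative `∂_j` (j = 1,2,3, here indexed by `Fin 3`). -/
def pd (j : Fin 3) (f : Fn) : Fn :=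
  fun t x => fderiv ℝ (f t) x (EuclideanSpace.single j 1)

/-- `∂_a` for `a ∈ {0,1,2,3}`, with `∂_0 = ∂_t`. -/
def pda (a : Fin 4) : Fn → Fn := Fin.cases pt (fun j => pd j) a

/-- Rotation field `Ω_{jk} = x_j ∂_k − x_k ∂_j`, extended antisymmetrically
(so `rotA k j = − rotA j k`, and `rotA j j = 0`). -/
def rotA (j k : Fin 3) (f : Fn) : Fn :=
  fun t x => x j * pd k f t x - x k * pd j f t x

/-- Radial derivative `∂_r = Σ_j (x_j/r) ∂_j`. -/
def pr (f : Fn) : Fn := fun t x => ∑ j, (x j / ‖x‖) * pd j f t x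

/-- `D_{+,c} = ∂_t + c ∂_r`. -/
def Dp (c : ℝ) (f : Fn) : Fn := fun t x => pt f t x + c * pr f t x

/-- `D_{−,c} = ∂_t − c ∂_r`. -/
def Dm (c : ℝ) (f : Fn) : Fn := fun t x => pt f t x - c * pr f t x

/-- The seven fields `Z = {∂_t, ∂_1, ∂_2, ∂_3, Ω_{12}, Ω_{13}, Ω_{23}}`. -/
def Zop : Fin 7 → Fn → Fn :=
  ![pt, pd 0, pd 1, pd 2, rotA 0 1, rotA 0 2, rotA 1 2]

/-- `Z^α = Z_1^{α_1} ⋯ Z_7^{α_7}`. -/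
def Zpow (α : Fin 7 → ℕ) (f : Fn) : Fn :=
  (Zop 0)^[α 0] <| (Zop 1)^[α 1] <| (Zop 2)^[α 2] <| (Zop 3)^[α 3] <|
    (Zop 4)^[α 4] <| (Zop 5)^[α 5] <| (Zop 6)^[α 6] f

/-- Multi-indices `α` (for the seven fields) with `|α| ≤ s`. -/
def multiIdx (s : ℕ) : Finset (Fin 7 → ℕ) :=
  (Fintype.piFinset fun _ => Finset.range (s + 1)).filter fun α => ∑ i, α i ≤ s

/-- `|v(t,x)|_s = Σ_{|α| ≤ s} |Z^α v(t,x)|`. -/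
def vnorm (s : ℕ) (f : Fn) (t : ℝ) (x : E3) : ℝ :=
  ∑ α ∈ multiIdx s, |Zpow α f t x|

/-- Smoothness of a space-time function. -/
def Smooth (f : Fn) : Prop := ContDiff ℝ (⊤ : ℕ∞) (fun p : ℝ × E3 => f p.1 p.2)

/-- `u` is a smooth solution of `∂_t²u − c²Δu = G` on `(0,∞)×ℝ³`
with zero initial data. -/
def IsWaveSol (c : ℝ) (G u : Fn) : Prop :=
  Smooth u ∧
    (∀ t x, 0 < t → pt (pt u) t x - c ^ 2 * ∑ j, pd j (pd j u) t x = G t x) ∧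
    (∀ x, u 0 x = 0) ∧ (∀ x, pt u 0 x = 0)

/-- `u` is a smooth solution of the free wave equation `∂_t²u − c²Δu = 0`
on `(0,∞)×ℝ³` with initial data `φ, ψ`. -/
def IsFreeWaveSol (c : ℝ) (φ ψ : SFn) (u : Fn) : Prop :=
  Smooth u ∧
    (∀ t x, 0 < t → pt (pt u) t x - c ^ 2 * ∑ j, pd j (pd j u) t x = 0) ∧
    (∀ x, u 0 x = φ x) ∧ (∀ x, pt u 0 x = ψ x)

/-- Extension of the speeds `c_1, …, c_N` by `c_0 = 0`. -/
def cs0 {N : ℕ} (cs : Fin N → ℝ) : Fin (N + 1) → ℝ := Fin.cases 0 cs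

/-- The weight `w(t,r) = min_{0 ≤ j ≤ N} ⟨c_j t − r⟩` (with `c_0 = 0`). -/
def wgt {N : ℕ} (cs : Fin N → ℝ) (t r : ℝ) : ℝ :=
  Finset.univ.inf' Finset.univ_nonempty fun j : Fin (N + 1) => jb (cs0 cs j * t - r)

/-- The weighted sup `A_{ρ,μ,s}[G;c](t,x)` over the backward cone `Λ_c(t,x)`. -/
def Afun (ρ μ : ℝ) (s : ℕ) (G : Fn) (c : ℝ) {N : ℕ} (cs : Fin N → ℝ)
    (t : ℝ) (x : E3) : ℝ :=
  sSup {a : ℝ | ∃ τ : ℝ, ∃ y : E3, 0 ≤ τ ∧ τ ≤ t ∧ ‖y - x‖ ≤ c * (t - τ) ∧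
    a = ‖y‖ * jb (τ + ‖y‖) ^ ρ * wgt cs τ ‖y‖ ^ (1 + μ) * vnorm s G τ y}

/-- Spatial derivative of a function of `x` alone. -/
def sd (j : Fin 3) (φ : SFn) : SFn :=
  fun x => fderiv ℝ φ x (EuclideanSpace.single j 1)

/-- Spatial rotation field for functions of `x` alone. -/
def srot (j k : Fin 3) (φ : SFn) : SFn :=
  fun x => x j * sd k φ x - x k * sd j φ x

/-- The six spatial fields `{∂_1, ∂_2, ∂_3, Ω_{12}, Ω_{13}, Ω_{23}}`. -/
def Sop : Fin 6 → SFn → SFn :=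
  ![sd 0, sd 1, sd 2, srot 0 1, srot 0 2, srot 1 2]

/-- `Z^α` for the spatial fields. -/
def Spow (α : Fin 6 → ℕ) (φ : SFn) : SFn :=
  (Sop 0)^[α 0] <| (Sop 1)^[α 1] <| (Sop 2)^[α 2] <| (Sop 3)^[α 3] <|
    (Sop 4)^[α 4] <| (Sop 5)^[α 5] φ

/-- Spatial multi-indices with `|α| ≤ s`. -/
def smultiIdx (s : ℕ) : Finset (Fin 6 → ℕ) :=
  (Fintype.piFinset fun _ => Finset.range (s + 1)).filter fun α => ∑ i, α i ≤ s

/-- `|φ(x)|_s` for a function of `x` alone. -/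
def snorm (s : ℕ) (φ : SFn) (x : E3) : ℝ :=
  ∑ α ∈ smultiIdx s, |Spow α φ x|

/-- The weighted sup `B_{ρ,s}[φ,ψ;c](t,x)`. -/
def Bfun (ρ : ℝ) (s : ℕ) (φ ψ : SFn) (c t : ℝ) (x : E3) : ℝ :=
  sSup {b : ℝ | ∃ y : E3, ‖y - x‖ ≤ c * t ∧
    b = jb ‖y‖ ^ ρ * (snorm (s + 1) φ y + snorm s ψ y)}

/-- `Φ_ρ(t,r)`. -/
def Phi (ρ t r : ℝ) : ℝ :=
  if ρ = 0 then Real.log (2 + jb (t + r) / jb (t - r)) else jb (t - r) ^ (-ρ)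

/-- `Ψ_ρ(t)`. -/
def Psi (ρ t : ℝ) : ℝ := if ρ = 0 then Real.log (2 + t) else 1

/-- The null form `Q_0(v,w;c) = (∂_t v)(∂_t w) − c²(∇v)·(∇w)`. -/
def Q0f (c : ℝ) (v w : Fn) : Fn :=
  fun t x => pt v t x * pt w t x - c ^ 2 * ∑ j, pd j v t x * pd j w t x

/-- The null form `Q_{ab}(v,w) = (∂_a v)(∂_b w) − (∂_b v)(∂_a w)`. -/
def Qab (a b : Fin 4) (v w : Fn) : Fn :=
  fun t x => pda a v t x * pda b w t x - pda b v t x * pda a w t x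

/-- Lorentz boost `L_{c,j} = (x_j/c)∂_t + c t ∂_j`. -/
def Lb (c : ℝ) (j : Fin 3) (f : Fn) : Fn :=
  fun t x => (x j / c) * pt f t x + c * t * pd j f t x

/-- Scaling field `S = t ∂_t + x·∇_x`. -/
def Sc (f : Fn) : Fn := fun t x => t * pt f t x + ∑ j, x j * pd j f t x

/-- `v(t,r,ω) = r u(t, rω)`. -/
def Vrad (u : Fn) (ω : E3) (t r : ℝ) : ℝ := r * u t (r • ω)

/-- `(∂_t + ∂_r) v` in the variables `(t,r)` for fixed `ω`. -/
def DpV (u : Fn) (ω : E3) (t r : ℝ) : ℝ :=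
  deriv (fun s => Vrad u ω s r) t + deriv (fun ρ' => Vrad u ω t ρ') r

/-- Cross product in ℝ³. -/
def cross3 (a b : Fin 3 → ℝ) : Fin 3 → ℝ :=
  ![a 1 * b 2 - a 2 * b 1, a 2 * b 0 - a 0 * b 2, a 0 * b 1 - a 1 * b 0]

/-- `Ωv = (Ω_{23}v, −Ω_{13}v, Ω_{12}v)`. -/
def OmegaVec (v : Fn) (t : ℝ) (x : E3) : Fin 3 → ℝ :=
  ![rotA 1 2 v t x, -(rotA 0 2 v t x), rotA 0 1 v t x]

/-- `∂^α` for a multi-index with `|α| ≤ 1`: either the identity or a single `∂_a`. -/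
def Dle1 : Option (Fin 4) → Fn → Fn
  | none => id
  | some a => pda a

/-- A linear combination, with constant real coefficients, of the null forms
`Q_0(u_j, ∂^α u_k; c)` and `Q_{ab}(u_j, ∂^α u_k)` with `0 ≤ a < b ≤ 3`, `|α| ≤ 1`. -/
def NullF (c : ℝ) (m : ℕ)
    (a0 : Fin m → Fin m → Fin m → Option (Fin 4) → ℝ)
    (aQ : Fin m → Fin m → Fin m → Fin 4 → Fin 4 → Option (Fin 4) → ℝ)
    (v : Fin m → Fn) (i : Fin m) : Fn := fun t x =>
  (∑ j, ∑ k, ∑ o : Option (Fin 4), a0 i j k o * Q0f c (v j) (Dle1 o (v k)) t x) +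
    ∑ j, ∑ k, ∑ p ∈ Finset.univ.filter (fun p : Fin 4 × Fin 4 => p.1 < p.2),
      ∑ o : Option (Fin 4), aQ i j k p.1 p.2 o * Qab p.1 p.2 (v j) (Dle1 o (v k)) t x

section WaveCalculus

open Real MeasureTheory Set intervalIntegral
open scoped ContDiff

lemma Smooth.hasFDerivAt {f : Fn} (hf : Smooth f) (p : ℝ × E3) :
    HasFDerivAt (fun p : ℝ × E3 => f p.1 p.2)
      (fderiv ℝ (fun p : ℝ × E3 => f p.1 p.2) p) p :=
  ((hf.differentiable (by simp)) p).hasFDerivAt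

lemma Smooth.pt_eq {f : Fn} (hf : Smooth f) (t : ℝ) (x : E3) :
    pt f t x = fderiv ℝ (fun p : ℝ × E3 => f p.1 p.2) (t, x) (1, 0) := by
  have h : HasDerivAt (fun s : ℝ => (s, x)) ((1 : ℝ), (0 : E3)) t :=
    (hasDerivAt_id t).prodMk (hasDerivAt_const t x)
  exact ((hf.hasFDerivAt (t, x)).comp_hasDerivAt t h).deriv

lemma Smooth.fderiv_slice {f : Fn} (hf : Smooth f) (t : ℝ) (x v : E3) :
    fderiv ℝ (f t) x v = fderiv ℝ (fun p : ℝ × E3 => f p.1 p.2) (t, x) (0, v) := by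
  have h : HasFDerivAt (fun y : E3 => (t, y)) (ContinuousLinearMap.inr ℝ ℝ E3) x :=
    hasFDerivAt_prodMk_right t x
  have h2 := ((hf.hasFDerivAt (t, x)).comp x h).fderiv
  have h3 : ((fun p : ℝ × E3 => f p.1 p.2) ∘ fun y : E3 => (t, y)) = f t := rfl
  rw [h3] at h2
  rw [h2]
  simp

lemma Smooth.pd_eq {f : Fn} (hf : Smooth f) (j : Fin 3) (t : ℝ) (x : E3) :
    pd j f t x =
      fderiv ℝ (fun p : ℝ × E3 => f p.1 p.2) (t, x) (0, EuclideanSpace.single j 1) :=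
  hf.fderiv_slice t x _

lemma Smooth.fderiv_apply {f : Fn} (hf : Smooth f) (v : ℝ × E3) :
    ContDiff ℝ ∞ (fun p => fderiv ℝ (fun p : ℝ × E3 => f p.1 p.2) p v) :=
  (ContDiff.fderiv_right (m := ∞) hf (by simp)).clm_apply contDiff_const

lemma Smooth.uncurry_pt {f : Fn} (hf : Smooth f) :
    (fun p : ℝ × E3 => pt f p.1 p.2) =
      fun p => fderiv ℝ (fun p : ℝ × E3 => f p.1 p.2) p (1, 0) := by
  ext p; exact hf.pt_eq p.1 p.2

lemma Smooth.uncurry_pd {f : Fn} (hf : Smooth f) (j : Fin 3) :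
    (fun p : ℝ × E3 => pd j f p.1 p.2) =
      fun p => fderiv ℝ (fun p : ℝ × E3 => f p.1 p.2) p (0, EuclideanSpace.single j 1) := by
  ext p; exact hf.pd_eq j p.1 p.2

lemma Smooth.smooth_pt {f : Fn} (hf : Smooth f) : Smooth (pt f) := by
  rw [Smooth, hf.uncurry_pt]
  exact hf.fderiv_apply _

lemma Smooth.smooth_pd {f : Fn} (hf : Smooth f) (j : Fin 3) : Smooth (pd j f) := by
  rw [Smooth, hf.uncurry_pd]
  exact hf.fderiv_apply _

lemma Smooth.smooth_rotA {f : Fn} (hf : Smooth f) (j k : Fin 3) : Smooth (rotA j k f) := by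
  have h1 : ContDiff ℝ ∞ (fun p : ℝ × E3 => pd j f p.1 p.2) := hf.smooth_pd j
  have h2 : ContDiff ℝ ∞ (fun p : ℝ × E3 => pd k f p.1 p.2) := hf.smooth_pd k
  have hx (i : Fin 3) : ContDiff ℝ ∞ (fun p : ℝ × E3 => p.2 i) := by fun_prop
  exact ((hx j).mul h2).sub ((hx k).mul h1)

lemma Smooth.continuous_comp {X : Type*} [TopologicalSpace X] {f : Fn} (hf : Smooth f)
    {a : X → ℝ} {γ : X → E3} (ha : Continuous a) (hγ : Continuous γ) :
    Continuous fun z => f (a z) (γ z) :=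
  (ContDiff.continuous hf).comp (ha.prodMk hγ)

lemma Smooth.slice {f : Fn} (hf : Smooth f) (t : ℝ) : ContDiff ℝ ∞ (f t) := by
  have : ContDiff ℝ ∞ (fun x : E3 => (t, x)) := by fun_prop
  exact ContDiff.comp (g := fun p : ℝ × E3 => f p.1 p.2) hf this

lemma Smooth.fderiv_second {f : Fn} (hf : Smooth f) (p v w : ℝ × E3) :
    fderiv ℝ (fun q => fderiv ℝ (fun p : ℝ × E3 => f p.1 p.2) q v) p w =
      fderiv ℝ (fderiv ℝ (fun p : ℝ × E3 => f p.1 p.2)) p w v := by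
  have h : Differentiable ℝ (fderiv ℝ (fun p : ℝ × E3 => f p.1 p.2)) :=
    (ContDiff.fderiv_right (m := ∞) hf (by simp)).differentiable (by simp)
  rw [fderiv_clm_apply (h p) (by fun_prop)]
  simp

lemma Smooth.fderiv_second_comm {f : Fn} (hf : Smooth f) (p v w : ℝ × E3) :
    fderiv ℝ (fun q => fderiv ℝ (fun p : ℝ × E3 => f p.1 p.2) q v) p w =
      fderiv ℝ (fun q => fderiv ℝ (fun p : ℝ × E3 => f p.1 p.2) q w) p v := by
  rw [hf.fderiv_second, hf.fderiv_second]
  have h : ContDiffAt ℝ ∞ (fun p : ℝ × E3 => f p.1 p.2) p := ContDiff.contDiffAt hf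
  exact h.isSymmSndFDerivAt (by simpa using WithTop.coe_le_coe.2 (le_top : (2 : ℕ∞) ≤ ⊤)) w v

lemma Smooth.pt_pd_comm {f : Fn} (hf : Smooth f) (j : Fin 3) :
    pt (pd j f) = pd j (pt f) := by
  ext t x
  rw [(hf.smooth_pd j).pt_eq, hf.smooth_pt.pd_eq, hf.uncurry_pt, hf.uncurry_pd,
    hf.fderiv_second_comm]

lemma Smooth.pd_pd_comm {f : Fn} (hf : Smooth f) (j k : Fin 3) :
    pd j (pd k f) = pd k (pd j f) := by
  ext t x
  rw [(hf.smooth_pd k).pd_eq, (hf.smooth_pd j).pd_eq, hf.uncurry_pd, hf.uncurry_pd,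
    hf.fderiv_second_comm]

lemma sum_coord_smul_single (v : E3) : v = ∑ j, v j • EuclideanSpace.single j (1 : ℝ) := by
  ext i
  simp [Fin.sum_univ_three]
  fin_cases i <;> simp

lemma fderiv_slice_eq_sum {f : Fn} (t : ℝ) (x v : E3) :
    fderiv ℝ (f t) x v = ∑ j, v j * pd j f t x := by
  conv_lhs => rw [sum_coord_smul_single v]
  simp [pd]

lemma Smooth.hasDerivAt_comp {f : Fn} (hf : Smooth f) {a : ℝ → ℝ} {a' s : ℝ} {γ : ℝ → E3}
    {γ' : E3} (ha : HasDerivAt a a' s) (hγ : HasDerivAt γ γ' s) :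
    HasDerivAt (fun s => f (a s) (γ s))
      (a' * pt f (a s) (γ s) + ∑ j, γ' j * pd j f (a s) (γ s)) s := by
  have h := (hf.hasFDerivAt (a s, γ s)).comp_hasDerivAt s (ha.prodMk hγ)
  have h2 : ((a', γ') : ℝ × E3) = a' • ((1 : ℝ), (0 : E3)) + (0, γ') := by simp
  rw [h2, map_add, map_smul, ← hf.pt_eq, ← hf.fderiv_slice, fderiv_slice_eq_sum] at h
  exact h

lemma Smooth.hasDerivAt_comp_space {f : Fn} (hf : Smooth f) (t : ℝ) {s : ℝ} {γ : ℝ → E3}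
    {γ' : E3} (hγ : HasDerivAt γ γ' s) :
    HasDerivAt (fun s => f t (γ s)) (∑ j, γ' j * pd j f t (γ s)) s := by
  simpa using hf.hasDerivAt_comp (hasDerivAt_const s t) hγ

end WaveCalculus

section Kirchhoff

open Real MeasureTheory Set intervalIntegral
open scoped ContDiff

/-- The outgoing derivative `(∂_t + ∂_s)(s w(t, x₀ + sθ))` on the ray `t = T - s`. -/
def coneFlux (w : Fn) (T : ℝ) (x₀ θ : E3) (s : ℝ) : ℝ :=
  s * pt w (T - s) (x₀ + s • θ) + w (T - s) (x₀ + s • θ) +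
    s * ∑ j, θ j * pd j w (T - s) (x₀ + s • θ)

/-- The derivative of `coneFlux` along the ray. -/
def coneFluxDeriv (w : Fn) (T : ℝ) (x₀ θ : E3) (s : ℝ) : ℝ :=
  -s * pt (pt w) (T - s) (x₀ + s • θ) +
    s * ∑ j, ∑ k, θ j * θ k * pd j (pd k w) (T - s) (x₀ + s • θ) +
    2 * ∑ j, θ j * pd j w (T - s) (x₀ + s • θ)

lemma hasDerivAt_ray (x₀ θ : E3) (s : ℝ) : HasDerivAt (fun s : ℝ => x₀ + s • θ) θ s := by
  simpa using ((hasDerivAt_id s).smul_const θ).const_add x₀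

lemma hasDerivAt_coneFlux {w : Fn} (hw : Smooth w) (T : ℝ) (x₀ θ : E3) (s : ℝ) :
    HasDerivAt (coneFlux w T x₀ θ) (coneFluxDeriv w T x₀ θ s) s := by
  have ha : HasDerivAt (fun s : ℝ => T - s) (-1) s := by
    simpa using (hasDerivAt_id s).const_sub T
  have hγ := hasDerivAt_ray x₀ θ s
  have h0 := hw.hasDerivAt_comp ha hγ
  have h1 := hw.smooth_pt.hasDerivAt_comp ha hγ
  have h2 := HasDerivAt.fun_sum (u := Finset.univ)
    fun j _ => ((hw.smooth_pd j).hasDerivAt_comp ha hγ).const_mul (θ j)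
  have h := (((hasDerivAt_id s).fun_mul h1).fun_add h0).fun_add ((hasDerivAt_id s).fun_mul h2)
  refine h.congr_deriv ?_
  simp only [coneFluxDeriv, hw.pt_pd_comm, Fin.sum_univ_three, id, hw.pd_pd_comm 1 0,
    hw.pd_pd_comm 2 0, hw.pd_pd_comm 2 1]
  ring

lemma continuous_coneFlux {X : Type*} [TopologicalSpace X] {w : Fn} (hw : Smooth w) (T : ℝ)
    (x₀ : E3) {θ : X → E3} {s : X → ℝ} (hθ : Continuous θ) (hs : Continuous s) :
    Continuous fun z => coneFlux w T x₀ (θ z) (s z) := by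
  have ha : Continuous fun z => T - s z := by fun_prop
  have hγ : Continuous fun z => x₀ + s z • θ z := by fun_prop
  have h0 := hw.continuous_comp ha hγ
  have h1 := hw.smooth_pt.continuous_comp ha hγ
  have h2 (j : Fin 3) := (hw.smooth_pd j).continuous_comp ha hγ
  have h3 : Continuous fun z => s z * ∑ j, θ z j * pd j w (T - s z) (x₀ + s z • θ z) := by
    fun_prop
  exact ((hs.mul h1).add h0).add h3

lemma continuous_coneFluxDeriv {X : Type*} [TopologicalSpace X] {w : Fn} (hw : Smooth w) (T : ℝ)
    (x₀ : E3) {θ : X → E3} {s : X → ℝ} (hθ : Continuous θ) (hs : Continuous s) :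
    Continuous fun z => coneFluxDeriv w T x₀ (θ z) (s z) := by
  have ha : Continuous fun z => T - s z := by fun_prop
  have hγ : Continuous fun z => x₀ + s z • θ z := by fun_prop
  have h1 := hw.smooth_pt.smooth_pt.continuous_comp ha hγ
  have h2 (j : Fin 3) := (hw.smooth_pd j).continuous_comp ha hγ
  have h3 (j k : Fin 3) := ((hw.smooth_pd k).smooth_pd j).continuous_comp ha hγ
  unfold coneFluxDeriv
  fun_prop

lemma hasDerivAt_linear_comb {a b c : ℝ → ℝ} {a' b' c' s : ℝ} (e : Fin 3 → E3)
    (ha : HasDerivAt a a' s) (hb : HasDerivAt b b' s) (hc : HasDerivAt c c' s) :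
    HasDerivAt (fun s => a s • e 0 + b s • e 1 + c s • e 2)
      (a' • e 0 + b' • e 1 + c' • e 2) s :=
  ((ha.smul_const _).fun_add (hb.smul_const _)).fun_add (hc.smul_const _)

lemma _root_.HasDerivAt.euclidean_apply {f : ℝ → E3} {f' : E3} {s : ℝ} (h : HasDerivAt f f' s)
    (j : Fin 3) : HasDerivAt (fun s => f s j) (f' j) s :=
  (EuclideanSpace.proj j : E3 →L[ℝ] ℝ).hasFDerivAt.comp_hasDerivAt s h

/-- The point of the unit sphere with polar angle `ϑ` and azimuth `φ` relative to a frame `e`. -/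
def sph (e : Fin 3 → E3) (ϑ φ : ℝ) : E3 :=
  (sin ϑ * cos φ) • e 0 + (sin ϑ * sin φ) • e 1 + cos ϑ • e 2

/-- The unit tangent vector of `sph` in the polar direction. -/
def sphPolar (e : Fin 3 → E3) (ϑ φ : ℝ) : E3 :=
  (cos ϑ * cos φ) • e 0 + (cos ϑ * sin φ) • e 1 + (-sin ϑ) • e 2

/-- The unit tangent vector of `sph` in the azimuthal direction. -/
def sphAzim (e : Fin 3 → E3) (φ : ℝ) : E3 :=
  (-sin φ) • e 0 + cos φ • e 1 + (0 : ℝ) • e 2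

/-- The derivative of `sphAzim`. -/
def sphAzimDeriv (e : Fin 3 → E3) (φ : ℝ) : E3 :=
  (-cos φ) • e 0 + (-sin φ) • e 1 + (0 : ℝ) • e 2

variable (e : Fin 3 → E3)

lemma continuous_sph : Continuous fun z : ℝ × ℝ => sph e z.1 z.2 := by
  unfold sph; fun_prop

lemma continuous_sphPolar : Continuous fun z : ℝ × ℝ => sphPolar e z.1 z.2 := by
  unfold sphPolar; fun_prop

lemma hasDerivAt_sph_polar (ϑ φ : ℝ) :
    HasDerivAt (fun ϑ => sph e ϑ φ) (sphPolar e ϑ φ) ϑ :=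
  hasDerivAt_linear_comb e ((hasDerivAt_sin ϑ).mul_const _) ((hasDerivAt_sin ϑ).mul_const _)
    (hasDerivAt_cos ϑ)

lemma hasDerivAt_sphPolar (ϑ φ : ℝ) :
    HasDerivAt (fun ϑ => sphPolar e ϑ φ) (-sph e ϑ φ) ϑ := by
  refine (hasDerivAt_linear_comb e ((hasDerivAt_cos ϑ).mul_const _)
    ((hasDerivAt_cos ϑ).mul_const _) (hasDerivAt_sin ϑ).fun_neg).congr_deriv ?_
  simp only [sph]
  module

lemma hasDerivAt_sph_azim (ϑ φ : ℝ) :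
    HasDerivAt (fun φ => sph e ϑ φ) (sin ϑ • sphAzim e φ) φ := by
  refine (hasDerivAt_linear_comb e ((hasDerivAt_cos φ).const_mul _)
    ((hasDerivAt_sin φ).const_mul _) (hasDerivAt_const φ (cos ϑ))).congr_deriv ?_
  simp only [sphAzim]
  module

lemma hasDerivAt_sphAzim (φ : ℝ) :
    HasDerivAt (fun φ => sphAzim e φ) (sphAzimDeriv e φ) φ :=
  hasDerivAt_linear_comb e (hasDerivAt_sin φ).fun_neg (hasDerivAt_cos φ) (hasDerivAt_const φ _)

/-- The sphere's first-order polar part of the Laplacian, `∂_ϑ (sin ϑ ∂_ϑ f)`, for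
`f = w(t, x₀ + s sph)`. -/
def polarPart (w : Fn) (t : ℝ) (x₀ : E3) (s ϑ φ : ℝ) : ℝ :=
  cos ϑ * (s * ∑ j, sphPolar e ϑ φ j * pd j w t (x₀ + s • sph e ϑ φ)) +
    sin ϑ * (s * ∑ j, (-sph e ϑ φ j * pd j w t (x₀ + s • sph e ϑ φ) +
      s * ∑ k, sphPolar e ϑ φ j * sphPolar e ϑ φ k * pd j (pd k w) t (x₀ + s • sph e ϑ φ)))

/-- The second azimuthal derivative `∂_φ² f` of `f = w(t, x₀ + s sph)`. -/
def azimPart (w : Fn) (t : ℝ) (x₀ : E3) (s ϑ φ : ℝ) : ℝ :=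
  s * sin ϑ * ∑ j, (sphAzimDeriv e φ j * pd j w t (x₀ + s • sph e ϑ φ) +
    s * sin ϑ * ∑ k, sphAzim e φ j * sphAzim e φ k * pd j (pd k w) t (x₀ + s • sph e ϑ φ))

variable {e}

lemma hasDerivAt_polarPart {w : Fn} (hw : Smooth w) (t : ℝ) (x₀ : E3) (s ϑ φ : ℝ) :
    HasDerivAt
      (fun ϑ => sin ϑ * (s * ∑ j, sphPolar e ϑ φ j * pd j w t (x₀ + s • sph e ϑ φ)))
      (polarPart e w t x₀ s ϑ φ) ϑ := by
  have hγ := ((hasDerivAt_sph_polar e ϑ φ).const_smul s).const_add x₀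
  have hp (j : Fin 3) : HasDerivAt (fun ϑ => sphPolar e ϑ φ j) (-sph e ϑ φ j) ϑ :=
    (hasDerivAt_sphPolar e ϑ φ).euclidean_apply j
  have h2 := HasDerivAt.fun_sum (u := Finset.univ)
    fun j _ => (hp j).fun_mul ((hw.smooth_pd j).hasDerivAt_comp_space t hγ)
  refine ((hasDerivAt_sin ϑ).fun_mul (h2.const_mul s)).congr_deriv ?_
  simp only [polarPart, Fin.sum_univ_three, hw.pd_pd_comm 1 0, PiLp.smul_apply, smul_eq_mul,
    hw.pd_pd_comm 2 0, hw.pd_pd_comm 2 1, Pi.smul_apply]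
  ring

lemma hasDerivAt_azimPart {w : Fn} (hw : Smooth w) (t : ℝ) (x₀ : E3) (s ϑ φ : ℝ) :
    HasDerivAt
      (fun φ => s * sin ϑ * ∑ j, sphAzim e φ j * pd j w t (x₀ + s • sph e ϑ φ))
      (azimPart e w t x₀ s ϑ φ) φ := by
  have hγ := ((hasDerivAt_sph_azim e ϑ φ).const_smul s).const_add x₀
  have hp (j : Fin 3) : HasDerivAt (fun φ => sphAzim e φ j) (sphAzimDeriv e φ j) φ :=
    (hasDerivAt_sphAzim e φ).euclidean_apply j
  have h2 := HasDerivAt.fun_sum (u := Finset.univ)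
    fun j _ => (hp j).fun_mul ((hw.smooth_pd j).hasDerivAt_comp_space t hγ)
  refine (h2.const_mul (s * sin ϑ)).congr_deriv ?_
  simp only [azimPart, Fin.sum_univ_three, hw.pd_pd_comm 1 0, PiLp.smul_apply, smul_eq_mul,
    hw.pd_pd_comm 2 0, hw.pd_pd_comm 2 1, Pi.smul_apply]
  ring

/-- Completeness of the frame `e`, in coordinates. -/
def IsFrame (e : Fin 3 → E3) : Prop :=
  ∀ j k, e 0 j * e 0 k + e 1 j * e 1 k + e 2 j * e 2 k = if j = k then 1 else 0

lemma sum_pd_pd_eq_frame (he : IsFrame e) (H : Fin 3 → Fin 3 → ℝ) (ϑ φ : ℝ) :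
    ∑ j, H j j = ∑ j, ∑ k, (sph e ϑ φ j * sph e ϑ φ k + sphPolar e ϑ φ j * sphPolar e ϑ φ k +
      sphAzim e φ j * sphAzim e φ k) * H j k := by
  have key (j k : Fin 3) : sph e ϑ φ j * sph e ϑ φ k + sphPolar e ϑ φ j * sphPolar e ϑ φ k +
      sphAzim e φ j * sphAzim e φ k = if j = k then 1 else 0 := by
    rw [← he j k]
    have h1 := sin_sq_add_cos_sq ϑ
    have h2 := sin_sq_add_cos_sq φ
    simp only [sph, sphPolar, sphAzim, PiLp.add_apply, PiLp.smul_apply, smul_eq_mul]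
    linear_combination ((cos φ * e 0 j + sin φ * e 1 j) * (cos φ * e 0 k + sin φ * e 1 k)
      + e 2 j * e 2 k) * h1 + (e 0 j * e 0 k + e 1 j * e 1 k) * h2
  simp [key]

lemma sin_mul_coneFluxDeriv {w : Fn} (he : IsFrame e) {T s : ℝ} {x₀ : E3} {ϑ φ : ℝ}
    (hwave : pt (pt w) (T - s) (x₀ + s • sph e ϑ φ) =
      ∑ j, pd j (pd j w) (T - s) (x₀ + s • sph e ϑ φ)) :
    sin ϑ * (s * (sin ϑ * coneFluxDeriv w T x₀ (sph e ϑ φ) s) +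
        polarPart e w (T - s) x₀ s ϑ φ) = -azimPart e w (T - s) x₀ s ϑ φ := by
  rw [coneFluxDeriv, hwave, sum_pd_pd_eq_frame he
    (fun j k => pd j (pd k w) (T - s) (x₀ + s • sph e ϑ φ)) ϑ φ, polarPart, azimPart]
  generalize T - s = t
  generalize x₀ + s • sph e ϑ φ = y
  have hlin (j : Fin 3) : sin ϑ * sph e ϑ φ j + cos ϑ * sphPolar e ϑ φ j =
      -sphAzimDeriv e φ j := by
    have h1 := sin_sq_add_cos_sq ϑ
    simp only [sph, sphPolar, sphAzimDeriv, PiLp.add_apply, PiLp.smul_apply, smul_eq_mul]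
    linear_combination (cos φ * e 0 j + sin φ * e 1 j) * h1
  simp only [Fin.sum_univ_three]
  linear_combination s * sin ϑ * (hlin 0 * pd 0 w t y + hlin 1 * pd 1 w t y + hlin 2 * pd 2 w t y)

end Kirchhoff

section SphericalMeans

open Real MeasureTheory Set intervalIntegral
open scoped ContDiff

variable {e : Fin 3 → E3}

lemma integral_swap_of_continuous (F : ℝ → ℝ → ℝ) (hF : Continuous fun z : ℝ × ℝ => F z.1 z.2)
    (a b c d : ℝ) :
    ∫ x in a..b, ∫ y in c..d, F x y = ∫ y in c..d, ∫ x in a..b, F x y := by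
  refine intervalIntegral_intervalIntegral_swap ?_
  have hF' : Continuous F.uncurry := hF
  exact (hF'.continuousOn.integrableOn_compact (isCompact_uIcc.prod isCompact_uIcc)).mono_set
    (prod_mono uIoc_subset_uIcc uIoc_subset_uIcc)

lemma continuous_integral_right {X : Type*} [TopologicalSpace X] (F : X → ℝ → ℝ)
    (hF : Continuous fun z : X × ℝ => F z.1 z.2) (a b : ℝ) :
    Continuous fun x => ∫ y in a..b, F x y :=
  continuous_parametric_intervalIntegral_of_continuous' (μ := volume) hF a b

lemma integral_eq_zero_of_Ioo {f : ℝ → ℝ} {a b : ℝ} (hab : a ≤ b)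
    (h : ∀ x ∈ Ioo a b, f x = 0) : ∫ x in a..b, f x = 0 := by
  rw [integral_of_le hab, integral_Ioc_eq_integral_Ioo]
  exact setIntegral_eq_zero_of_forall_eq_zero h

lemma continuous_polarPart {w : Fn} (hw : Smooth w) (t : ℝ) (x₀ : E3) (s : ℝ) :
    Continuous fun z : ℝ × ℝ => polarPart e w t x₀ s z.1 z.2 := by
  have hγ : Continuous fun z : ℝ × ℝ => x₀ + s • sph e z.1 z.2 := by
    have := continuous_sph e
    fun_prop
  have h1 (j : Fin 3) := (hw.smooth_pd j).continuous_comp (continuous_const (y := t)) hγ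
  have h2 (j k : Fin 3) :=
    ((hw.smooth_pd k).smooth_pd j).continuous_comp (continuous_const (y := t)) hγ
  have h3 (j : Fin 3) : Continuous fun z : ℝ × ℝ => sphPolar e z.1 z.2 j := by
    have := continuous_sphPolar e
    fun_prop
  have h4 (j : Fin 3) : Continuous fun z : ℝ × ℝ => sph e z.1 z.2 j := by
    have := continuous_sph e
    fun_prop
  have hcos : Continuous fun z : ℝ × ℝ => cos z.1 := by fun_prop
  have hsin : Continuous fun z : ℝ × ℝ => sin z.1 := by fun_prop
  exact (hcos.mul (continuous_const.mul (continuous_finsetSum _ fun j _ => (h3 j).mul (h1 j)))).add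
    (hsin.mul (continuous_const.mul (continuous_finsetSum _ fun j _ =>
      ((h4 j).neg.mul (h1 j)).add (continuous_const.mul (continuous_finsetSum _ fun k _ =>
        ((h3 j).mul (h3 k)).mul (h2 j k))))))

lemma continuous_azimPart {w : Fn} (hw : Smooth w) (t : ℝ) (x₀ : E3) (s ϑ : ℝ) :
    Continuous fun φ : ℝ => azimPart e w t x₀ s ϑ φ := by
  have hγ : Continuous fun φ : ℝ => x₀ + s • sph e ϑ φ := by
    unfold sph
    fun_prop
  have h1 (j : Fin 3) := (hw.smooth_pd j).continuous_comp (continuous_const (y := t)) hγ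
  have h2 (j k : Fin 3) :=
    ((hw.smooth_pd k).smooth_pd j).continuous_comp (continuous_const (y := t)) hγ
  have h3 (j : Fin 3) : Continuous fun φ : ℝ => sphAzimDeriv e φ j := by
    unfold sphAzimDeriv
    fun_prop
  have h4 (j : Fin 3) : Continuous fun φ : ℝ => sphAzim e φ j := by
    unfold sphAzim
    fun_prop
  exact continuous_const.mul (continuous_finsetSum _ fun j _ =>
    ((h3 j).mul (h1 j)).add (continuous_const.mul (continuous_finsetSum _ fun k _ =>
      ((h4 j).mul (h4 k)).mul (h2 j k))))

lemma integral_azimPart {w : Fn} (hw : Smooth w) (t : ℝ) (x₀ : E3) (s ϑ : ℝ) :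
    ∫ φ in (0 : ℝ)..2 * π, azimPart e w t x₀ s ϑ φ = 0 := by
  rw [integral_eq_sub_of_hasDerivAt (fun φ _ => hasDerivAt_azimPart hw t x₀ s ϑ φ)
    ((continuous_azimPart hw t x₀ s ϑ).intervalIntegrable _ _)]
  simp [sphAzim, sph]

lemma integral_polarPart {w : Fn} (hw : Smooth w) (t : ℝ) (x₀ : E3) (s : ℝ) :
    ∫ ϑ in (0 : ℝ)..π, ∫ φ in (0 : ℝ)..2 * π, polarPart e w t x₀ s ϑ φ = 0 := by
  have hc := continuous_polarPart (e := e) hw t x₀ s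
  rw [integral_swap_of_continuous (polarPart e w t x₀ s) hc]
  refine integral_eq_zero_of_Ioo (by positivity) fun φ _ => ?_
  rw [integral_eq_sub_of_hasDerivAt (fun ϑ _ => hasDerivAt_polarPart hw t x₀ s ϑ φ)]
  · simp
  · exact (hc.comp (by fun_prop : Continuous fun ϑ : ℝ => (ϑ, φ))).intervalIntegrable _ _

lemma integral_coneFluxDeriv {w : Fn} (hw : Smooth w) (he : IsFrame e) {T s : ℝ} (hs : 0 < s)
    (x₀ : E3) (hwave : ∀ x, pt (pt w) (T - s) x = ∑ j, pd j (pd j w) (T - s) x) :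
    ∫ ϑ in (0 : ℝ)..π, ∫ φ in (0 : ℝ)..2 * π,
      sin ϑ * coneFluxDeriv w T x₀ (sph e ϑ φ) s = 0 := by
  have hD : Continuous fun z : ℝ × ℝ => sin z.1 * coneFluxDeriv w T x₀ (sph e z.1 z.2) s :=
    (by fun_prop : Continuous fun z : ℝ × ℝ => sin z.1).mul
      (continuous_coneFluxDeriv hw T x₀ (continuous_sph e) continuous_const)
  have hA := continuous_polarPart (e := e) hw (T - s) x₀ s
  have hD1 (ϑ : ℝ) : IntervalIntegrable
      (fun φ => sin ϑ * coneFluxDeriv w T x₀ (sph e ϑ φ) s) volume 0 (2 * π) :=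
    (hD.comp (by fun_prop : Continuous fun φ : ℝ => (ϑ, φ))).intervalIntegrable _ _
  have hA1 (ϑ : ℝ) : IntervalIntegrable
      (polarPart e w (T - s) x₀ s ϑ) volume 0 (2 * π) :=
    (hA.comp (by fun_prop : Continuous fun φ : ℝ => (ϑ, φ))).intervalIntegrable _ _
  have hD2 := (continuous_integral_right
    (fun ϑ φ => sin ϑ * coneFluxDeriv w T x₀ (sph e ϑ φ) s) hD 0
      (2 * π)).intervalIntegrable (μ := volume) 0 π
  have hA2 := (continuous_integral_right
    (polarPart e w (T - s) x₀ s) hA 0 (2 * π)).intervalIntegrable (μ := volume) 0 π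
  have hzero : ∫ ϑ in (0 : ℝ)..π,
      (s * ∫ φ in (0 : ℝ)..2 * π, sin ϑ * coneFluxDeriv w T x₀ (sph e ϑ φ) s) +
        ∫ φ in (0 : ℝ)..2 * π, polarPart e w (T - s) x₀ s ϑ φ = 0 := by
    refine integral_eq_zero_of_Ioo pi_pos.le fun ϑ hϑ => ?_
    have hsin := sin_pos_of_mem_Ioo hϑ
    refine (mul_eq_zero.1 ?_).resolve_left hsin.ne'
    rw [← intervalIntegral.integral_const_mul, ← intervalIntegral.integral_add
      ((hD1 ϑ).const_mul s) (hA1 ϑ), ← intervalIntegral.integral_const_mul]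
    rw [intervalIntegral.integral_congr (g := fun φ => -azimPart e w (T - s) x₀ s ϑ φ)
      fun φ _ => sin_mul_coneFluxDeriv he (hwave _)]
    rw [intervalIntegral.integral_neg, integral_azimPart hw, neg_zero]
  rw [intervalIntegral.integral_add (hD2.const_mul s) hA2, integral_polarPart hw, add_zero,
    intervalIntegral.integral_const_mul] at hzero
  exact (mul_eq_zero.1 hzero).resolve_left hs.ne'

lemma integral_integral_eq_of_hasDerivAt {F F' : ℝ → ℝ → ℝ → ℝ} {a b c d T : ℝ} (hT : 0 ≤ T)
    (hF : ∀ s, Continuous fun z : ℝ × ℝ => F s z.1 z.2)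
    (hF' : Continuous fun z : (ℝ × ℝ) × ℝ => F' z.1.2 z.1.1 z.2)
    (hderiv : ∀ s x y, HasDerivAt (fun s => F s x y) (F' s x y) s)
    (hzero : ∀ s ∈ Ioo 0 T, ∫ x in a..b, ∫ y in c..d, F' s x y = 0) :
    ∫ x in a..b, ∫ y in c..d, F T x y = ∫ x in a..b, ∫ y in c..d, F 0 x y := by
  have hF1 (s x : ℝ) : IntervalIntegrable (F s x) volume c d :=
    ((hF s).comp (by fun_prop : Continuous fun y : ℝ => (x, y))).intervalIntegrable _ _
  have hF2 (s : ℝ) : IntervalIntegrable (fun x => ∫ y in c..d, F s x y) volume a b :=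
    (continuous_integral_right (F s) (hF s) c d).intervalIntegrable _ _
  have hstep (x : ℝ) : (∫ y in c..d, F T x y) - ∫ y in c..d, F 0 x y =
      ∫ s in (0 : ℝ)..T, ∫ y in c..d, F' s x y := by
    rw [← intervalIntegral.integral_sub (hF1 T x) (hF1 0 x), integral_swap_of_continuous
      (fun s y => F' s x y) (hF'.comp (by fun_prop : Continuous fun z : ℝ × ℝ => ((x, z.1), z.2)))]
    refine intervalIntegral.integral_congr fun y _ => ?_
    symm
    exact integral_eq_sub_of_hasDerivAt (fun s _ => hderiv s x y)
      ((hF'.comp (by fun_prop : Continuous fun s : ℝ => ((x, s), y))).intervalIntegrable _ _)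
  rw [← sub_eq_zero, ← intervalIntegral.integral_sub (hF2 T) (hF2 0)]
  simp_rw [hstep]
  rw [integral_swap_of_continuous (fun x s => ∫ y in c..d, F' s x y)
    (continuous_integral_right (fun (z : ℝ × ℝ) y => F' z.2 z.1 y) hF' c d)]
  exact integral_eq_zero_of_Ioo hT hzero

/-- Kirchhoff's formula, in polar coordinates relative to a frame. -/
lemma kirchhoff {w : Fn} (hw : Smooth w) (he : IsFrame e)
    (hwave : ∀ t x, 0 < t → pt (pt w) t x = ∑ j, pd j (pd j w) t x)
    {T : ℝ} (hT : 0 ≤ T) (x₀ : E3) :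
    4 * π * w T x₀ =
      ∫ ϑ in (0 : ℝ)..π, ∫ φ in (0 : ℝ)..2 * π, sin ϑ * coneFlux w T x₀ (sph e ϑ φ) T := by
  have hF (s : ℝ) : Continuous fun z : ℝ × ℝ => sin z.1 * coneFlux w T x₀ (sph e z.1 z.2) s :=
    (by fun_prop : Continuous fun z : ℝ × ℝ => sin z.1).mul
      (continuous_coneFlux hw T x₀ (continuous_sph e) continuous_const)
  have hD : Continuous fun z : (ℝ × ℝ) × ℝ =>
      sin z.1.1 * coneFluxDeriv w T x₀ (sph e z.1.1 z.2) z.1.2 :=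
    (by fun_prop : Continuous fun z : (ℝ × ℝ) × ℝ => sin z.1.1).mul
      (continuous_coneFluxDeriv hw T x₀ ((continuous_sph e).comp
        (by fun_prop : Continuous fun z : (ℝ × ℝ) × ℝ => (z.1.1, z.2))) (by fun_prop))
  rw [integral_integral_eq_of_hasDerivAt
    (F := fun s ϑ φ => sin ϑ * coneFlux w T x₀ (sph e ϑ φ) s)
    (F' := fun s ϑ φ => sin ϑ * coneFluxDeriv w T x₀ (sph e ϑ φ) s) hT hF hD
    (fun s ϑ φ => (hasDerivAt_coneFlux hw T x₀ (sph e ϑ φ) s).const_mul (sin ϑ))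
    fun s hs => integral_coneFluxDeriv hw he hs.1 x₀ fun x => hwave _ x (sub_pos.2 hs.2)]
  simp [coneFlux]
  ring

end SphericalMeans

section Rotations

open Real

lemma Smooth.pt_rotA {f : Fn} (hf : Smooth f) (j k : Fin 3) :
    pt (rotA j k f) = rotA j k (pt f) := by
  ext t x
  have h (i : Fin 3) : HasDerivAt (fun s => pd i f s x) (pd i (pt f) t x) t := by
    simpa [hf.pt_pd_comm] using
      (hf.smooth_pd i).hasDerivAt_comp (hasDerivAt_id t) (hasDerivAt_const t x)
  exact (((h k).const_mul (x j)).sub ((h j).const_mul (x k))).deriv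

lemma Smooth.pd_coord_mul {f : Fn} (hf : Smooth f) (i j : Fin 3) (t : ℝ) (x : E3) :
    fderiv ℝ (fun x : E3 => x j * f t x) x (EuclideanSpace.single i 1) =
      (if i = j then 1 else 0) * f t x + x j * pd i f t x := by
  have h1 : HasFDerivAt (fun x : E3 => x j) (EuclideanSpace.proj j : E3 →L[ℝ] ℝ) x :=
    (EuclideanSpace.proj j : E3 →L[ℝ] ℝ).hasFDerivAt
  have h2 := ((hf.slice t).differentiable (by simp) x).hasFDerivAt
  rw [(h1.fun_mul h2).fderiv]
  simp [pd, add_comm, mul_comm, eq_comm]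

lemma Smooth.pd_rotA {f : Fn} (hf : Smooth f) (i j k : Fin 3) (t : ℝ) (x : E3) :
    pd i (rotA j k f) t x =
      (if i = j then 1 else 0) * pd k f t x + x j * pd i (pd k f) t x -
        ((if i = k then 1 else 0) * pd j f t x + x k * pd i (pd j f) t x) := by
  have hd (l m : Fin 3) : DifferentiableAt ℝ (fun x : E3 => x l * pd m f t x) x := by
    have := ((hf.smooth_pd m).slice t).differentiable (by simp) x
    have h1 : DifferentiableAt ℝ (fun x : E3 => x l) x := by fun_prop
    exact h1.fun_mul this
  rw [← (hf.smooth_pd k).pd_coord_mul, ← (hf.smooth_pd j).pd_coord_mul]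
  change fderiv ℝ (fun x : E3 => x j * pd k f t x - x k * pd j f t x) x _ = _
  rw [fderiv_fun_sub (hd j k) (hd k j)]
  rfl

lemma Smooth.pd_add {f g : Fn} (hf : Smooth f) (hg : Smooth g) (i : Fin 3) (t : ℝ) (x : E3) :
    pd i (fun t x => f t x + g t x) t x = pd i f t x + pd i g t x := by
  have h1 := (hf.slice t).differentiable (by simp) x
  have h2 := (hg.slice t).differentiable (by simp) x
  change fderiv ℝ (fun x => f t x + g t x) x _ = _
  rw [fderiv_fun_add h1 h2]
  rfl

lemma Smooth.pd_pd_rotA {f : Fn} (hf : Smooth f) (i j k : Fin 3) (t : ℝ) (x : E3) :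
    pd i (pd i (rotA j k f)) t x =
      2 * (if i = j then 1 else 0) * pd i (pd k f) t x + x j * pd k (pd i (pd i f)) t x -
        (2 * (if i = k then 1 else 0) * pd i (pd j f) t x + x k * pd j (pd i (pd i f)) t x) := by
  have hrot : pd i (rotA j k f) = fun t x =>
      ((if i = j then 1 else 0) * pd k f t x - (if i = k then 1 else 0) * pd j f t x) +
        rotA j k (pd i f) t x := by
    ext t x
    rw [hf.pd_rotA, rotA, hf.pd_pd_comm k i, hf.pd_pd_comm j i]
    ring
  have hs : Smooth fun t x =>
      (if i = j then 1 else 0) * pd k f t x - (if i = k then 1 else 0) * pd j f t x :=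
    (contDiff_const.mul (hf.smooth_pd k)).sub (contDiff_const.mul (hf.smooth_pd j))
  rw [hrot, hs.pd_add ((hf.smooth_pd i).smooth_rotA j k), (hf.smooth_pd i).pd_rotA]
  have hd (m : Fin 3) := ((hf.smooth_pd m).slice t).differentiable (by simp) x
  have h1 : pd i (fun t x => (if i = j then (1 : ℝ) else 0) * pd k f t x -
      (if i = k then 1 else 0) * pd j f t x) t x =
      (if i = j then 1 else 0) * pd i (pd k f) t x -
        (if i = k then 1 else 0) * pd i (pd j f) t x := by
    change fderiv ℝ (fun x => (if i = j then (1 : ℝ) else 0) * pd k f t x -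
      (if i = k then 1 else 0) * pd j f t x) x _ = _
    rw [fderiv_fun_sub ((hd k).const_mul _) ((hd j).const_mul _), fderiv_const_mul (hd k),
      fderiv_const_mul (hd j)]
    rfl
  rw [h1, hf.pd_pd_comm k i, hf.pd_pd_comm j i, (hf.smooth_pd i).pd_pd_comm k i,
    (hf.smooth_pd i).pd_pd_comm j i, hf.pd_pd_comm k i, hf.pd_pd_comm j i]
  ring

lemma Smooth.sum_pd_pd_rotA {f : Fn} (hf : Smooth f) (j k : Fin 3) (t : ℝ) (x : E3) :
    ∑ i, pd i (pd i (rotA j k f)) t x =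
      x j * ∑ i, pd k (pd i (pd i f)) t x - x k * ∑ i, pd j (pd i (pd i f)) t x := by
  simp_rw [hf.pd_pd_rotA, Finset.sum_sub_distrib, Finset.sum_add_distrib, ← Finset.mul_sum]
  simp [hf.pd_pd_comm k j]

/-- The homogeneous wave equation for positive times. -/
def SolvesWave (w : Fn) : Prop :=
  ∀ t x, 0 < t → pt (pt w) t x = ∑ j, pd j (pd j w) t x

lemma SolvesWave.rotA {w : Fn} (h : SolvesWave w) (hw : Smooth w) (j k : Fin 3) :
    SolvesWave (rotA j k w) := by
  intro t x ht
  have hslice : pt (pt w) t = fun x => ∑ j, pd j (pd j w) t x := funext fun x => h t x ht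
  have hpd (l : Fin 3) : pd l (pt (pt w)) t x = ∑ i, pd l (pd i (pd i w)) t x := by
    rw [pd, hslice, fderiv_fun_sum fun i _ =>
      (((hw.smooth_pd i).smooth_pd i).slice t).differentiable (by simp) x]
    simp [pd]
  rw [hw.pt_rotA, hw.smooth_pt.pt_rotA, hw.sum_pd_pd_rotA, PaperKatayama.rotA, hpd, hpd]

lemma IsFreeWaveSol.solvesWave {φ ψ : SFn} {u : Fn} (h : IsFreeWaveSol 1 φ ψ u) :
    SolvesWave u := by
  intro t x ht
  have := h.2.1 t x ht
  linarith

lemma IsFreeWaveSol.rotA {φ ψ : SFn} {u : Fn} (h : IsFreeWaveSol 1 φ ψ u) (j k : Fin 3) :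
    IsFreeWaveSol 1 (srot j k φ) (srot j k ψ) (rotA j k u) := by
  refine ⟨h.1.smooth_rotA j k, fun t x ht => ?_, fun x => ?_, fun x => ?_⟩
  · rw [h.solvesWave.rotA h.1 j k t x ht]
    ring
  · rw [← (funext h.2.2.1 : u 0 = φ)]
    rfl
  · rw [h.1.pt_rotA, ← (funext h.2.2.2 : pt u 0 = ψ)]
    rfl

lemma mul_coneFluxDeriv_eq_rotA {u : Fn} (hu : Smooth u) (hwave : SolvesWave u) {T s : ℝ}
    (hs : s < T) {ω : E3} (hω : ‖ω‖ = 1) :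
    s * coneFluxDeriv u T 0 ω s =
      -(rotA 0 1 (rotA 0 1 u) (T - s) (s • ω) + rotA 0 2 (rotA 0 2 u) (T - s) (s • ω) +
        rotA 1 2 (rotA 1 2 u) (T - s) (s • ω)) := by
  have hsum : ω 0 ^ 2 + ω 1 ^ 2 + ω 2 ^ 2 = 1 := by
    have := EuclideanSpace.real_norm_sq_eq ω
    rw [hω, Fin.sum_univ_three] at this
    linarith
  rw [coneFluxDeriv, hwave _ _ (sub_pos.2 hs), zero_add]
  rw [rotA, hu.pd_rotA, hu.pd_rotA, rotA, hu.pd_rotA, hu.pd_rotA, rotA, hu.pd_rotA, hu.pd_rotA]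
  simp only [Fin.sum_univ_three, hu.pd_pd_comm 1 0, hu.pd_pd_comm 2 0, hu.pd_pd_comm 2 1,
    PiLp.smul_apply, smul_eq_mul]
  generalize T - s = t
  generalize s • ω = x
  simp
  linear_combination (pd 0 (pd 0 u) t x + pd 1 (pd 1 u) t x + pd 2 (pd 2 u) t x) * s ^ 2 * hsum

end Rotations

section PointwiseDecay

open Real MeasureTheory Set intervalIntegral

lemma isFrame_orthonormalBasis (b : OrthonormalBasis (Fin 3) ℝ E3) : IsFrame b := by
  intro j k
  have h := b.sum_inner_mul_inner (EuclideanSpace.single j (1 : ℝ))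
    (EuclideanSpace.single k (1 : ℝ))
  simpa [Fin.sum_univ_three, EuclideanSpace.inner_single_left, EuclideanSpace.inner_single_right,
    Pi.single_apply, eq_comm] using h

lemma exists_orthonormalBasis_two_eq {ω : E3} (hω : ‖ω‖ = 1) :
    ∃ b : OrthonormalBasis (Fin 3) ℝ E3, b 2 = ω := by
  have hv : Orthonormal ℝ (({2} : Set (Fin 3)).domRestrict fun _ => ω) := by
    refine ⟨fun _ => hω, fun i j hij => absurd (Subsingleton.elim i j) hij⟩
  obtain ⟨b, hb⟩ := hv.exists_orthonormalBasis_extension_of_card_eq (by simp)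
  exact ⟨b, hb 2 rfl⟩

lemma norm_sq_linear_comb (b : OrthonormalBasis (Fin 3) ℝ E3) (p q r : ℝ) :
    ‖p • b 0 + q • b 1 + r • b 2‖ ^ 2 = p ^ 2 + q ^ 2 + r ^ 2 := by
  rw [← real_inner_self_eq_norm_sq]
  simp only [inner_add_left, inner_add_right, real_inner_smul_left, real_inner_smul_right,
    orthonormal_iff_ite.1 b.orthonormal]
  simp
  ring

lemma norm_sq_add_sph (b : OrthonormalBasis (Fin 3) ℝ E3) (l T ϑ φ : ℝ) :
    ‖l • b 2 + T • sph b ϑ φ‖ ^ 2 = l ^ 2 + T ^ 2 + 2 * l * T * cos ϑ := by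
  have h : l • b 2 + T • sph b ϑ φ =
      (T * sin ϑ * cos φ) • b 0 + (T * sin ϑ * sin φ) • b 1 + (l + T * cos ϑ) • b 2 := by
    unfold sph
    module
  rw [h, norm_sq_linear_comb]
  linear_combination T ^ 2 * sin ϑ ^ 2 * sin_sq_add_cos_sq φ + T ^ 2 * sin_sq_add_cos_sq ϑ

lemma norm_sph (b : OrthonormalBasis (Fin 3) ℝ E3) (ϑ φ : ℝ) : ‖sph b ϑ φ‖ = 1 := by
  have h := norm_sq_add_sph b 0 1 ϑ φ
  simp only [zero_smul, one_smul, zero_add] at h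
  have h0 := norm_nonneg (sph b ϑ φ)
  nlinarith

/-- The integral of the weight `⟨y⟩^{-ρ}` over the sphere of radius `T` centred at distance `l`
from the origin, up to normalisation. -/
def sphWeight (ρ T l : ℝ) : ℝ :=
  ∫ ϑ in (0 : ℝ)..π, sin ϑ * (1 + (l ^ 2 + T ^ 2 + 2 * l * T * cos ϑ)) ^ (-(ρ / 2))

lemma sq_sub_le_sphere (l T ϑ : ℝ) (hl : 0 ≤ l) (hT : 0 ≤ T) :
    (l - T) ^ 2 ≤ l ^ 2 + T ^ 2 + 2 * l * T * cos ϑ := by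
  nlinarith [neg_one_le_cos ϑ, mul_nonneg hl hT]

lemma continuous_sphWeight_integrand (ρ l T : ℝ) (hl : 0 ≤ l) (hT : 0 ≤ T) :
    Continuous fun ϑ => sin ϑ * (1 + (l ^ 2 + T ^ 2 + 2 * l * T * cos ϑ)) ^ (-(ρ / 2)) := by
  have hb : Continuous fun ϑ => 1 + (l ^ 2 + T ^ 2 + 2 * l * T * cos ϑ) := by fun_prop
  refine continuous_sin.mul (hb.rpow_const fun ϑ => Or.inl ?_)
  have := sq_sub_le_sphere l T ϑ hl hT
  nlinarith [sq_nonneg (l - T)]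

lemma abs_coneFlux_le {w : Fn} {T N : ℝ} {x₀ θ : E3} (hT : 0 ≤ T) (hθ : ‖θ‖ = 1)
    (h0 : |w 0 (x₀ + T • θ)| ≤ N) (h1 : |pt w 0 (x₀ + T • θ)| ≤ N)
    (h2 : ∀ j, |pd j w 0 (x₀ + T • θ)| ≤ N) :
    |coneFlux w T x₀ θ T| ≤ (1 + 4 * T) * N := by
  have hj (j : Fin 3) : |θ j * pd j w 0 (x₀ + T • θ)| ≤ N := by
    have hθj : |θ j| ≤ 1 := by
      rw [← hθ]
      exact PiLp.norm_apply_le θ j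
    rw [abs_mul]
    nlinarith [abs_nonneg (θ j), abs_nonneg (pd j w 0 (x₀ + T • θ)), h2 j]
  have hsum : |∑ j, θ j * pd j w 0 (x₀ + T • θ)| ≤ 3 * N := by
    refine (Finset.abs_sum_le_sum_abs _ _).trans ((Finset.sum_le_sum fun j _ => hj j).trans ?_)
    simp
  rw [coneFlux, sub_self]
  refine (abs_add_three _ _ _).trans ?_
  rw [abs_mul, abs_mul, abs_of_nonneg hT]
  nlinarith [mul_le_mul_of_nonneg_left h1 hT, mul_le_mul_of_nonneg_left hsum hT]

lemma abs_le_sphWeight {w : Fn} (hw : Smooth w) (hwave : SolvesWave w) {ρ M T l : ℝ} {ω : E3}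
    (hω : ‖ω‖ = 1) (hl : 0 ≤ l) (hT : 0 ≤ T)
    (h0 : ∀ y, ‖y - l • ω‖ ≤ T → |w 0 y| ≤ M * (1 + ‖y‖ ^ 2) ^ (-(ρ / 2)))
    (h1 : ∀ y, ‖y - l • ω‖ ≤ T → |pt w 0 y| ≤ M * (1 + ‖y‖ ^ 2) ^ (-(ρ / 2)))
    (h2 : ∀ j y, ‖y - l • ω‖ ≤ T → |pd j w 0 y| ≤ M * (1 + ‖y‖ ^ 2) ^ (-(ρ / 2))) :
    |w T (l • ω)| ≤ 2 * M * ((1 + T) * sphWeight ρ T l) := by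
  obtain ⟨b, rfl⟩ := exists_orthonormalBasis_two_eq hω
  have hM : 0 ≤ M := by
    have h := (abs_nonneg _).trans (h0 (l • b 2) (by simpa using hT))
    exact nonneg_of_mul_nonneg_left h (by positivity)
  have hk := kirchhoff hw (isFrame_orthonormalBasis b) hwave hT (l • b 2)
  have hcont := continuous_sphWeight_integrand ρ l T hl hT
  have hpt (ϑ : ℝ) (hϑ : ϑ ∈ Icc 0 π) (φ : ℝ) :
      |sin ϑ * coneFlux w T (l • b 2) (sph b ϑ φ) T| ≤ (1 + 4 * T) * M *
        (sin ϑ * (1 + (l ^ 2 + T ^ 2 + 2 * l * T * cos ϑ)) ^ (-(ρ / 2))) := by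
    have hmem : ‖l • b 2 + T • sph b ϑ φ - l • b 2‖ ≤ T := by
      simp [norm_smul, norm_sph, abs_of_nonneg hT]
    have h := abs_coneFlux_le hT (norm_sph b ϑ φ) (h0 _ hmem) (h1 _ hmem) fun j => h2 j _ hmem
    rw [norm_sq_add_sph] at h
    rw [abs_mul, abs_of_nonneg (sin_nonneg_of_mem_Icc hϑ)]
    calc sin ϑ * |coneFlux w T (l • b 2) (sph b ϑ φ) T| ≤ sin ϑ * _ :=
          mul_le_mul_of_nonneg_left h (sin_nonneg_of_mem_Icc hϑ)
      _ = _ := by ring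
  have hinner (ϑ : ℝ) (hϑ : ϑ ∈ Icc 0 π) :
      ‖∫ φ in (0 : ℝ)..2 * π, sin ϑ * coneFlux w T (l • b 2) (sph b ϑ φ) T‖ ≤
        (2 * π * ((1 + 4 * T) * M)) *
          (sin ϑ * (1 + (l ^ 2 + T ^ 2 + 2 * l * T * cos ϑ)) ^ (-(ρ / 2))) := by
    refine (norm_integral_le_of_norm_le_const fun φ _ => hpt ϑ hϑ φ).trans (le_of_eq ?_)
    rw [sub_zero, abs_of_pos two_pi_pos]
    ring
  have hout := norm_integral_le_of_norm_le (μ := volume) pi_pos.le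
    (Filter.Eventually.of_forall fun ϑ hϑ => hinner ϑ (Ioc_subset_Icc_self hϑ))
    ((hcont.const_mul _).intervalIntegrable 0 π)
  rw [← hk, intervalIntegral.integral_const_mul, norm_mul, norm_eq_abs, norm_eq_abs,
    abs_of_pos (by positivity : (0 : ℝ) < 4 * π)] at hout
  change _ ≤ 2 * π * ((1 + 4 * T) * M) * sphWeight ρ T l at hout
  have hS : 0 ≤ sphWeight ρ T l := by
    refine intervalIntegral.integral_nonneg pi_pos.le fun ϑ hϑ => ?_
    have := sq_sub_le_sphere l T ϑ hl hT
    exact mul_nonneg (sin_nonneg_of_mem_Icc hϑ) (rpow_nonneg (by nlinarith [sq_nonneg (l - T)]) _)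
  have hMS : 0 ≤ M * sphWeight ρ T l := mul_nonneg hM hS
  have : 4 * π * |w T (l • b 2)| ≤ 4 * π * (2 * M * ((1 + T) * sphWeight ρ T l)) :=
    hout.trans (by nlinarith [mul_nonneg pi_pos.le hMS])
  exact le_of_mul_le_mul_left this (by positivity)

/-- Bound of the weight away from the light cone. -/
lemma sphWeight_le_const {ρ T l : ℝ} (hρ : 0 ≤ ρ) (hl : 0 ≤ l) (hT : 0 ≤ T) :
    sphWeight ρ T l ≤ 2 * (1 + (l - T) ^ 2) ^ (-(ρ / 2)) := by
  have h : sphWeight ρ T l ≤ ∫ ϑ in (0 : ℝ)..π, sin ϑ * (1 + (l - T) ^ 2) ^ (-(ρ / 2)) := by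
    refine integral_mono_on pi_pos.le
      ((continuous_sphWeight_integrand ρ l T hl hT).intervalIntegrable _ _)
      ((continuous_sin.mul continuous_const).intervalIntegrable _ _) fun ϑ hϑ => ?_
    refine mul_le_mul_of_nonneg_left ?_ (sin_nonneg_of_mem_Icc hϑ)
    exact rpow_le_rpow_of_nonpos (by positivity)
      (by linarith [sq_sub_le_sphere l T ϑ hl hT]) (by linarith)
  refine h.trans (le_of_eq ?_)
  rw [intervalIntegral.integral_mul_const, integral_sin]
  norm_num

/-- Bound of the weight by exact integration. -/
lemma mul_sphWeight_le {σ T l : ℝ} (hσ : 0 < σ) (hl : 0 < l) (hT : 0 < T) :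
    T * sphWeight (σ + 2) T l ≤ 1 / (σ * l) * (1 + (l - T) ^ 2) ^ (-(σ / 2)) := by
  have hpos (ϑ : ℝ) : 0 < 1 + (l ^ 2 + T ^ 2 + 2 * l * T * cos ϑ) := by
    nlinarith [sq_sub_le_sphere l T ϑ hl.le hT.le, sq_nonneg (l - T)]
  have hderiv (ϑ : ℝ) : HasDerivAt
      (fun ϑ => 1 / (σ * l * T) * (1 + (l ^ 2 + T ^ 2 + 2 * l * T * cos ϑ)) ^ (-(σ / 2)))
      (sin ϑ * (1 + (l ^ 2 + T ^ 2 + 2 * l * T * cos ϑ)) ^ (-((σ + 2) / 2))) ϑ := by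
    have h1 : HasDerivAt (fun ϑ => 1 + (l ^ 2 + T ^ 2 + 2 * l * T * cos ϑ))
        (2 * l * T * -sin ϑ) ϑ :=
      (((hasDerivAt_cos ϑ).const_mul (2 * l * T)).const_add _).const_add _
    refine ((h1.rpow_const (p := -(σ / 2)) (Or.inl (hpos ϑ).ne')).const_mul
      (1 / (σ * l * T))).congr_deriv ?_
    rw [show -(σ / 2) - 1 = -((σ + 2) / 2) by ring]
    field_simp
  rw [sphWeight, integral_eq_sub_of_hasDerivAt (fun ϑ _ => hderiv ϑ)
    ((continuous_sphWeight_integrand (σ + 2) l T hl.le hT.le).intervalIntegrable _ _)]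
  have h0 : 0 ≤ (1 + (l ^ 2 + T ^ 2 + 2 * l * T * cos 0)) ^ (-(σ / 2)) :=
    rpow_nonneg (hpos 0).le _
  have hπ : 1 + (l ^ 2 + T ^ 2 + 2 * l * T * cos π) = 1 + (l - T) ^ 2 := by
    rw [cos_pi]; ring
  rw [hπ]
  calc T * (1 / (σ * l * T) * (1 + (l - T) ^ 2) ^ (-(σ / 2)) -
        1 / (σ * l * T) * (1 + (l ^ 2 + T ^ 2 + 2 * l * T * cos 0)) ^ (-(σ / 2)))
      ≤ T * (1 / (σ * l * T) * (1 + (l - T) ^ 2) ^ (-(σ / 2))) := by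
        refine mul_le_mul_of_nonneg_left (sub_le_self _ ?_) hT.le
        positivity
    _ = _ := by field_simp

end PointwiseDecay

section ConeIntegral

open Real MeasureTheory Set intervalIntegral

lemma one_add_mul_sphWeight_le {σ T l : ℝ} (hσ : 0 < σ) (hl : 1 ≤ l) (hT : 0 ≤ T) :
    (1 + T) * sphWeight (σ + 2) T l ≤
      (2 / σ + 8) * (1 / l * (1 + (l - T) ^ 2) ^ (-(σ / 2))) := by
  have hl0 : 0 < l := by linarith
  have hW : 0 ≤ 1 / l * (1 + (l - T) ^ 2) ^ (-(σ / 2)) := by positivity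
  rcases le_total 1 T with h1 | h1
  · have hT0 : 0 < T := by linarith
    have h := mul_sphWeight_le hσ hl0 hT0
    have hS : 0 ≤ sphWeight (σ + 2) T l := by
      refine intervalIntegral.integral_nonneg pi_pos.le fun ϑ hϑ => ?_
      have := sq_sub_le_sphere l T ϑ hl0.le hT
      exact mul_nonneg (sin_nonneg_of_mem_Icc hϑ) (rpow_nonneg (by nlinarith [sq_nonneg (l - T)]) _)
    calc (1 + T) * sphWeight (σ + 2) T l ≤ 2 * (T * sphWeight (σ + 2) T l) := by nlinarith
      _ ≤ 2 * (1 / (σ * l) * (1 + (l - T) ^ 2) ^ (-(σ / 2))) := by linarith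
      _ = 2 / σ * (1 / l * (1 + (l - T) ^ 2) ^ (-(σ / 2))) := by field_simp
      _ ≤ _ := by nlinarith
  · have h := sphWeight_le_const (ρ := σ + 2) (by linarith) hl0.le hT
    have hsplit : (1 + (l - T) ^ 2) ^ (-((σ + 2) / 2)) =
        (1 + (l - T) ^ 2) ^ (-(σ / 2)) * (1 + (l - T) ^ 2)⁻¹ := by
      rw [← rpow_neg_one, ← rpow_add (by positivity)]
      congr 1
      ring
    have hinv : (1 + (l - T) ^ 2)⁻¹ ≤ 2 * (1 / l) := by
      rw [inv_eq_one_div, mul_one_div, div_le_div_iff₀ (by positivity) hl0]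
      nlinarith [sq_nonneg (l - T - 1)]
    have hP : 0 ≤ (1 + (l - T) ^ 2) ^ (-(σ / 2)) := by positivity
    calc (1 + T) * sphWeight (σ + 2) T l
        ≤ (1 + T) * (2 * (1 + (l - T) ^ 2) ^ (-((σ + 2) / 2))) :=
          mul_le_mul_of_nonneg_left h (by linarith)
      _ ≤ 2 * (2 * (1 + (l - T) ^ 2) ^ (-((σ + 2) / 2))) :=
          mul_le_mul_of_nonneg_right (by linarith) (by positivity)
      _ ≤ 2 * (2 * ((1 + (l - T) ^ 2) ^ (-(σ / 2)) * (2 * (1 / l)))) := by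
          rw [hsplit]
          gcongr
      _ = 8 * (1 / l * (1 + (l - T) ^ 2) ^ (-(σ / 2))) := by ring
      _ ≤ _ := by
          have : 0 ≤ 2 / σ := by positivity
          nlinarith

lemma sphWeight_near_axis_le {κ μ l R : ℝ} (hκ : 1 ≤ κ) (hμ : 0 < μ) (hl : 1 ≤ l)
    (hlR : l ≤ R / 4) :
    (1 + (R - l)) * sphWeight (κ + μ + 1) (R - l) l ≤
      4 * 2 ^ (κ + μ + 1) * (R ^ (-κ) * R ^ (-μ)) := by
  have hR : 0 < R := by linarith
  have h := sphWeight_le_const (ρ := κ + μ + 1) (l := l) (T := R - l) (by linarith) (by linarith)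
    (by linarith)
  have hbase : (1 + (l - (R - l)) ^ 2) ^ (-((κ + μ + 1) / 2)) ≤ (R / 2) ^ (-(κ + μ + 1)) := by
    have h2 : (R / 2) ^ (-(κ + μ + 1)) = ((R / 2) ^ 2) ^ (-((κ + μ + 1) / 2)) := by
      rw [← rpow_natCast, ← rpow_mul (by positivity)]
      congr 1
      push_cast
      ring
    rw [h2]
    exact rpow_le_rpow_of_nonpos (by positivity) (by nlinarith) (by linarith)
  have hpow : R * (R / 2) ^ (-(κ + μ + 1)) = 2 ^ (κ + μ + 1) * (R ^ (-κ) * R ^ (-μ)) := by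
    rw [div_rpow hR.le (by norm_num), rpow_neg (by norm_num : (0 : ℝ) ≤ 2), ← rpow_add hR]
    rw [show -(κ + μ + 1) = (-κ + -μ) - 1 by ring, rpow_sub_one hR.ne']
    field_simp
  calc (1 + (R - l)) * sphWeight (κ + μ + 1) (R - l) l
      ≤ (1 + (R - l)) * (2 * (1 + (l - (R - l)) ^ 2) ^ (-((κ + μ + 1) / 2))) :=
        mul_le_mul_of_nonneg_left h (by linarith)
    _ ≤ (2 * R) * (2 * (R / 2) ^ (-(κ + μ + 1))) := by
        gcongr
        linarith
    _ = 4 * (R * (R / 2) ^ (-(κ + μ + 1))) := by ring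
    _ = _ := by rw [hpow]; ring

lemma sphWeight_far_from_axis_le {κ μ l R : ℝ} (hκ1 : 1 ≤ κ) (hκ2 : κ ≤ 2) (hμ : 0 < μ)
    (hl : 1 ≤ l) (hRl : R / 4 ≤ l) (hlR : l ≤ R) :
    1 / l * ((1 + (R - l)) * sphWeight (κ + μ + 1) (R - l) l) ≤
      32 * (2 / (κ - 1 + μ) + 8) *
        (R ^ (-κ) * (1 + (2 * l - R) ^ 2) ^ (-(1 + μ) / 2)) := by
  have hR : 1 ≤ R := by linarith
  have hR0 : 0 < R := by linarith
  have hl0 : 0 < l := by linarith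
  have hσ : 0 < κ - 1 + μ := by linarith
  have h := one_add_mul_sphWeight_le (T := R - l) hσ hl (by linarith)
  rw [show κ - 1 + μ + 2 = κ + μ + 1 by ring, show l - (R - l) = 2 * l - R by ring] at h
  have hC : 0 ≤ 2 / (κ - 1 + μ) + 8 := by positivity
  have hinv : 1 / l ≤ 4 / R := by
    rw [div_le_div_iff₀ hl0 hR0]
    linarith
  have hsplit : (1 + (2 * l - R) ^ 2) ^ (-((κ - 1 + μ) / 2)) =
      (1 + (2 * l - R) ^ 2) ^ (-(1 + μ) / 2) * (1 + (2 * l - R) ^ 2) ^ ((2 - κ) / 2) := by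
    rw [← rpow_add (by positivity)]
    congr 1
    ring
  have hgrow : (1 + (2 * l - R) ^ 2) ^ ((2 - κ) / 2) ≤ 2 * R ^ (2 - κ) := by
    calc (1 + (2 * l - R) ^ 2) ^ ((2 - κ) / 2) ≤ (2 * R ^ 2) ^ ((2 - κ) / 2) := by
          refine rpow_le_rpow (by positivity) ?_ (by linarith)
          nlinarith
      _ = 2 ^ ((2 - κ) / 2) * R ^ (2 - κ) := by
          rw [mul_rpow (by norm_num) (by positivity), ← rpow_natCast, ← rpow_mul hR0.le]
          congr 2
          push_cast
          ring
      _ ≤ 2 * R ^ (2 - κ) := by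
          gcongr
          calc (2 : ℝ) ^ ((2 - κ) / 2) ≤ 2 ^ (1 : ℝ) :=
                rpow_le_rpow_of_exponent_le (by norm_num) (by linarith)
            _ = 2 := rpow_one 2
  have hJ : 0 ≤ (1 + (2 * l - R) ^ 2) ^ (-(1 + μ) / 2) := by positivity
  calc 1 / l * ((1 + (R - l)) * sphWeight (κ + μ + 1) (R - l) l)
      ≤ 1 / l * ((2 / (κ - 1 + μ) + 8) *
          (1 / l * (1 + (2 * l - R) ^ 2) ^ (-((κ - 1 + μ) / 2)))) :=
        mul_le_mul_of_nonneg_left h (by positivity)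
    _ ≤ 4 / R * ((2 / (κ - 1 + μ) + 8) * (4 / R *
          ((1 + (2 * l - R) ^ 2) ^ (-(1 + μ) / 2) * (2 * R ^ (2 - κ))))) := by
        rw [hsplit]
        gcongr
    _ = _ := by
        rw [show 2 - κ = -κ + 2 by ring, rpow_add hR0, rpow_two]
        field_simp
        ring

lemma continuous_bracket_rpow (p : ℝ) : Continuous fun x : ℝ => (1 + x ^ 2) ^ p :=
  (by fun_prop : Continuous fun x : ℝ => 1 + x ^ 2).rpow_const
    fun x => Or.inl (by positivity)

lemma integral_bracket_le {μ a b : ℝ} (hμ : 0 < μ) (hab : a ≤ b) :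
    ∫ x in a..b, (1 + x ^ 2) ^ (-(1 + μ) / 2) ≤ ∫ x : ℝ, (1 + x ^ 2) ^ (-(1 + μ) / 2) := by
  have hint : Integrable fun x : ℝ => (1 + x ^ 2) ^ (-(1 + μ) / 2) := by
    have := integrable_rpow_neg_one_add_norm_sq (E := ℝ) (μ := volume) (r := 1 + μ) (by simpa)
    simpa using this
  rw [integral_of_le hab]
  exact setIntegral_le_integral hint (Filter.Eventually.of_forall fun x => by positivity)

/-- Along the incoming ray from `(0, R)`, the weighted spherical means divided by `l` are
dominated by a function with integral `O(R^{-κ})`. -/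
lemma exists_cone_majorant {κ μ : ℝ} (hκ1 : 1 ≤ κ) (hκ2 : κ ≤ 2) (hμ : 0 < μ) :
    ∃ C ≥ (0 : ℝ), ∀ r R : ℝ, 1 ≤ r → r ≤ R → ∃ g : ℝ → ℝ, IntervalIntegrable g volume r R ∧
      (∀ l ∈ Icc r R, 1 / l * ((1 + (R - l)) * sphWeight (κ + μ + 1) (R - l) l) ≤ g l) ∧
      ∫ l in r..R, g l ≤ C * R ^ (-κ) := by
  set C₁ : ℝ := 4 * 2 ^ (κ + μ + 1)
  set C₂ : ℝ := 32 * (2 / (κ - 1 + μ) + 8)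
  set K : ℝ := ∫ x : ℝ, (1 + x ^ 2) ^ (-(1 + μ) / 2)
  have hσ : 0 < κ - 1 + μ := by linarith
  have hC₁ : 0 ≤ C₁ := by positivity
  have hC₂ : 0 ≤ C₂ := by positivity
  have hK : 0 ≤ K := integral_nonneg fun x => by positivity
  refine ⟨C₁ / μ + C₂ * K, by positivity, fun r R hr hrR => ?_⟩
  have hR : 1 ≤ R := hr.trans hrR
  have hR0 : 0 < R := by linarith
  have hr0 : 0 < r := by linarith
  have hcont : Continuous fun l : ℝ => (1 + (2 * l - R) ^ 2) ^ (-(1 + μ) / 2) :=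
    (continuous_bracket_rpow _).comp (by fun_prop : Continuous fun l : ℝ => 2 * l - R)
  have hi1 : IntervalIntegrable (fun l => C₁ * (R ^ (-κ) * R ^ (-μ)) * l⁻¹) volume r R := by
    refine IntervalIntegrable.const_mul (intervalIntegrable_inv (fun l hl => ?_) continuousOn_id) _
    rw [uIcc_of_le hrR] at hl
    exact (hr0.trans_le hl.1).ne'
  have hi2 : IntervalIntegrable
      (fun l => C₂ * R ^ (-κ) * (1 + (2 * l - R) ^ 2) ^ (-(1 + μ) / 2)) volume r R :=
    (hcont.const_mul _).intervalIntegrable _ _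
  refine ⟨_, hi1.add hi2, fun l hl => ?_, ?_⟩
  · have hl1 : 1 ≤ l := hr.trans hl.1
    have hl0 : 0 < l := by linarith
    have hn1 : 0 ≤ C₁ * (R ^ (-κ) * R ^ (-μ)) * l⁻¹ := by positivity
    have hn2 : 0 ≤ C₂ * R ^ (-κ) * (1 + (2 * l - R) ^ 2) ^ (-(1 + μ) / 2) := by positivity
    rcases le_total l (R / 4) with h | h
    · have := mul_le_mul_of_nonneg_left (sphWeight_near_axis_le hκ1 hμ hl1 h)
        (by positivity : 0 ≤ 1 / l)
      refine this.trans ((le_of_eq ?_).trans (le_add_of_nonneg_right hn2))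
      simp only [C₁]
      ring
    · refine (sphWeight_far_from_axis_le hκ1 hκ2 hμ hl1 h hl.2).trans
        ((le_of_eq ?_).trans (le_add_of_nonneg_left hn1))
      simp only [C₂]
      ring
  · rw [intervalIntegral.integral_add hi1 hi2, intervalIntegral.integral_const_mul,
      intervalIntegral.integral_const_mul, integral_inv_of_pos hr0 hR0]
    have hlog : log (R / r) ≤ R ^ μ / μ :=
      (log_le_log (by positivity) (div_le_self hR0.le hr)).trans (log_le_rpow_div hR0.le hμ)
    have hJ : ∫ l in r..R, (1 + (2 * l - R) ^ 2) ^ (-(1 + μ) / 2) ≤ K := by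
      rw [intervalIntegral.integral_comp_mul_sub
        (fun x : ℝ => (1 + x ^ 2) ^ (-(1 + μ) / 2)) two_ne_zero R, smul_eq_mul]
      have := integral_bracket_le hμ (by linarith : 2 * r - R ≤ 2 * R - R)
      linarith
    have hcancel : R ^ (-μ) * R ^ μ = 1 := by
      rw [← rpow_add hR0, neg_add_cancel, rpow_zero]
    calc C₁ * (R ^ (-κ) * R ^ (-μ)) * log (R / r) +
          C₂ * R ^ (-κ) * ∫ l in r..R, (1 + (2 * l - R) ^ 2) ^ (-(1 + μ) / 2)
        ≤ C₁ * (R ^ (-κ) * R ^ (-μ)) * (R ^ μ / μ) + C₂ * R ^ (-κ) * K := by gcongr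
      _ = C₁ / μ * R ^ (-κ) * (R ^ (-μ) * R ^ μ) + C₂ * K * R ^ (-κ) := by ring
      _ = _ := by rw [hcancel]; ring

end ConeIntegral

section DataNorms

open Set

lemma abs_Spow_le_snorm {s : ℕ} {α : Fin 6 → ℕ} (hα : ∑ i, α i ≤ s) (φ : SFn) (x : E3) :
    |Spow α φ x| ≤ snorm s φ x := by
  refine Finset.single_le_sum (f := fun α => |Spow α φ x|) (fun _ _ => abs_nonneg _) ?_
  simp only [smultiIdx, Finset.mem_filter, Fintype.mem_piFinset, Finset.mem_range]
  exact ⟨fun i => Nat.lt_succ_of_le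
    ((Finset.single_le_sum (fun _ _ => Nat.zero_le _) (Finset.mem_univ i)).trans hα), hα⟩

lemma abs_le_snorm (s : ℕ) (φ : SFn) (x : E3) : |φ x| ≤ snorm s φ x :=
  abs_Spow_le_snorm (α := 0) (by simp) φ x

lemma abs_sd_le_snorm {s : ℕ} (hs : 1 ≤ s) (j : Fin 3) (φ : SFn) (x : E3) :
    |sd j φ x| ≤ snorm s φ x := by
  let α : Fin 6 → ℕ :=
    ![if j = 0 then 1 else 0, if j = 1 then 1 else 0, if j = 2 then 1 else 0, 0, 0, 0]
  have h : Spow α φ = sd j φ := by fin_cases j <;> rfl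
  rw [← h]
  exact abs_Spow_le_snorm (le_trans (by fin_cases j <;> decide) hs) φ x

lemma abs_srot_srot_le_snorm {s : ℕ} (hs : 2 ≤ s) {a b : Fin 3} (hab : a < b) (φ : SFn) (x : E3) :
    |srot a b (srot a b φ) x| ≤ snorm s φ x := by
  let α : Fin 6 → ℕ :=
    ![0, 0, 0, if b = 1 then 2 else 0, if a = 0 ∧ b = 2 then 2 else 0, if a = 1 then 2 else 0]
  have h : Spow α φ = srot a b (srot a b φ) := by
    fin_cases a <;> fin_cases b <;> first | rfl | exact absurd hab (by decide)
  rw [← h]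
  refine abs_Spow_le_snorm (le_trans ?_ hs) φ x
  fin_cases a <;> fin_cases b <;> first | decide | exact absurd hab (by decide)

lemma abs_sd_srot_srot_le_snorm {s : ℕ} (hs : 3 ≤ s) (j : Fin 3) {a b : Fin 3} (hab : a < b)
    (φ : SFn) (x : E3) : |sd j (srot a b (srot a b φ)) x| ≤ snorm s φ x := by
  let α : Fin 6 → ℕ :=
    ![if j = 0 then 1 else 0, if j = 1 then 1 else 0, if j = 2 then 1 else 0,
      if b = 1 then 2 else 0, if a = 0 ∧ b = 2 then 2 else 0, if a = 1 then 2 else 0]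
  have h : Spow α φ = sd j (srot a b (srot a b φ)) := by
    fin_cases a <;> fin_cases b <;> first
      | exact absurd hab (by decide)
      | fin_cases j <;> rfl
  rw [← h]
  refine abs_Spow_le_snorm (le_trans ?_ hs) φ x
  fin_cases a <;> fin_cases b <;> first
    | exact absurd hab (by decide)
    | fin_cases j <;> decide

lemma snorm_nonneg (s : ℕ) (φ : SFn) (x : E3) : 0 ≤ snorm s φ x :=
  Finset.sum_nonneg fun _ _ => abs_nonneg _

lemma contDiff_sd {φ : SFn} (hφ : ContDiff ℝ (⊤ : ℕ∞) φ) (j : Fin 3) :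
    ContDiff ℝ (⊤ : ℕ∞) (sd j φ) :=
  (hφ.fderiv_right (m := (⊤ : ℕ∞)) (by simp)).clm_apply contDiff_const

lemma contDiff_srot {φ : SFn} (hφ : ContDiff ℝ (⊤ : ℕ∞) φ) (j k : Fin 3) :
    ContDiff ℝ (⊤ : ℕ∞) (srot j k φ) := by
  have h (i : Fin 3) : ContDiff ℝ (⊤ : ℕ∞) fun x : E3 => x i :=
    (EuclideanSpace.proj i : E3 →L[ℝ] ℝ).contDiff
  exact ((h j).mul (contDiff_sd hφ k)).sub ((h k).mul (contDiff_sd hφ j))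

lemma contDiff_iterate_Sop {φ : SFn} (hφ : ContDiff ℝ (⊤ : ℕ∞) φ) (i : Fin 6) (n : ℕ) :
    ContDiff ℝ (⊤ : ℕ∞) ((Sop i)^[n] φ) := by
  induction n with
  | zero => exact hφ
  | succ n ih =>
    rw [Function.iterate_succ_apply']
    fin_cases i
    exacts [contDiff_sd ih 0, contDiff_sd ih 1, contDiff_sd ih 2, contDiff_srot ih 0 1,
      contDiff_srot ih 0 2, contDiff_srot ih 1 2]

lemma continuous_snorm {φ : SFn} (hφ : ContDiff ℝ (⊤ : ℕ∞) φ) (s : ℕ) :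
    Continuous (snorm s φ) := by
  refine continuous_finsetSum _ fun α _ => ?_
  have h : ContDiff ℝ (⊤ : ℕ∞) (Spow α φ) := by
    iterate 6 refine contDiff_iterate_Sop ?_ _ _
    exact hφ
  exact h.continuous.abs

lemma jb_rpow (a p : ℝ) : jb a ^ p = (1 + a ^ 2) ^ (p / 2) := by
  rw [jb, Real.sqrt_eq_rpow, ← Real.rpow_mul (by positivity)]
  ring_nf

lemma snorm_add_snorm_le_Bfun {φ ψ : SFn} (hφ : ContDiff ℝ (⊤ : ℕ∞) φ)
    (hψ : ContDiff ℝ (⊤ : ℕ∞) ψ) (ρ : ℝ) (s : ℕ) {c t : ℝ} {x y : E3} (hy : ‖y - x‖ ≤ c * t) :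
    snorm (s + 1) φ y + snorm s ψ y ≤ Bfun ρ s φ ψ c t x * (1 + ‖y‖ ^ 2) ^ (-(ρ / 2)) := by
  let F : E3 → ℝ := fun y => jb ‖y‖ ^ ρ * (snorm (s + 1) φ y + snorm s ψ y)
  have hF : Continuous F := by
    have h : Continuous fun y : E3 => jb ‖y‖ ^ ρ := by
      simp_rw [jb_rpow]
      exact (continuous_bracket_rpow _).comp continuous_norm
    exact h.mul ((continuous_snorm hφ _).add (continuous_snorm hψ _))
  have himage : {b : ℝ | ∃ y : E3, ‖y - x‖ ≤ c * t ∧ b = F y} =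
      F '' Metric.closedBall x (c * t) := by
    ext b
    simp [dist_eq_norm, eq_comm]
  have hle : F y ≤ Bfun ρ s φ ψ c t x := by
    refine le_csSup ?_ ⟨y, hy, rfl⟩
    rw [himage]
    exact (isCompact_closedBall x (c * t)).bddAbove_image hF.continuousOn
  have hpos : 0 < 1 + ‖y‖ ^ 2 := by positivity
  calc snorm (s + 1) φ y + snorm s ψ y
      = F y * (1 + ‖y‖ ^ 2) ^ (-(ρ / 2)) := by
        simp only [F]
        rw [jb_rpow, mul_right_comm, ← Real.rpow_add hpos, add_neg_cancel, Real.rpow_zero, one_mul]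
    _ ≤ _ := by gcongr

lemma le_Bfun_mul_of_le_snorm {φ ψ : SFn} (hφ : ContDiff ℝ (⊤ : ℕ∞) φ)
    (hψ : ContDiff ℝ (⊤ : ℕ∞) ψ) (ρ : ℝ) (s : ℕ) {c t : ℝ} {x y : E3} (hy : ‖y - x‖ ≤ c * t)
    {a : ℝ} (ha : a ≤ snorm (s + 1) φ y ∨ a ≤ snorm s ψ y) :
    a ≤ Bfun ρ s φ ψ c t x * (1 + ‖y‖ ^ 2) ^ (-(ρ / 2)) := by
  have h := snorm_add_snorm_le_Bfun hφ hψ ρ s hy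
  have h1 := snorm_nonneg (s + 1) φ y
  have h2 := snorm_nonneg s ψ y
  rcases ha with ha | ha <;> linarith

end DataNorms

section OutgoingDerivative

open Real MeasureTheory Set intervalIntegral

lemma deriv_Vrad_add_deriv_Vrad {u : Fn} (hu : Smooth u) (t r : ℝ) (ω : E3) :
    deriv (fun s => Vrad u ω s r) t + deriv (fun ρ => Vrad u ω t ρ) r =
      coneFlux u (t + r) 0 ω r := by
  have h1 : HasDerivAt (fun s => u s (r • ω)) (pt u t (r • ω)) t := by
    simpa using hu.hasDerivAt_comp (hasDerivAt_id t) (hasDerivAt_const t (r • ω))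
  have h2 := hu.hasDerivAt_comp_space t (hasDerivAt_ray 0 ω r)
  simp only [zero_add] at h2
  have h3 : HasDerivAt (fun s => Vrad u ω s r) (r * pt u t (r • ω)) t := h1.const_mul r
  have h4 := (hasDerivAt_id r).fun_mul h2
  simp only [id] at h4
  rw [h3.deriv, show (fun ρ => Vrad u ω t ρ) = fun ρ => ρ * u t (ρ • ω) from rfl, h4.deriv,
    coneFlux, add_sub_cancel_right, zero_add]
  ring

lemma IsFreeWaveSol.abs_initial_le {φ ψ : SFn} {u : Fn} (h : IsFreeWaveSol 1 φ ψ u) {N : ℝ} {y : E3}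
    (h0 : |φ y| ≤ N) (h1 : |ψ y| ≤ N) (h2 : ∀ j, |sd j φ y| ≤ N) :
    |u 0 y| ≤ N ∧ |pt u 0 y| ≤ N ∧ ∀ j, |pd j u 0 y| ≤ N := by
  refine ⟨by rwa [h.2.2.1], by rwa [h.2.2.2], fun j => ?_⟩
  have := h2 j
  rwa [← (funext h.2.2.1 : u 0 = φ)] at this

lemma norm_sub_smul_le {ω y : E3} (hω : ‖ω‖ = 1) {t r l : ℝ} (hl : r ≤ l)
    (hy : ‖y - l • ω‖ ≤ t + r - l) : ‖y - r • ω‖ ≤ 1 * t := by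
  have h : ‖l • ω - r • ω‖ = l - r := by
    rw [← sub_smul, norm_smul, hω, mul_one, norm_eq_abs, abs_of_nonneg (sub_nonneg.2 hl)]
  have := norm_sub_le_norm_sub_add_norm_sub y (l • ω) (r • ω)
  linarith

lemma abs_rotA_rotA_le {φ ψ : SFn} {u : Fn} (hφ : ContDiff ℝ (⊤ : ℕ∞) φ)
    (hψ : ContDiff ℝ (⊤ : ℕ∞) ψ) (hu : IsFreeWaveSol 1 φ ψ u) (ρ : ℝ) {t r l : ℝ} {ω : E3}
    (hω : ‖ω‖ = 1) (hr : 0 ≤ r) (hrl : r ≤ l) (hl : l ≤ t + r) {a b : Fin 3} (hab : a < b) :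
    |rotA a b (rotA a b u) (t + r - l) (l • ω)| ≤ 2 * Bfun ρ 2 φ ψ 1 t (r • ω) *
      ((1 + (t + r - l)) * sphWeight ρ (t + r - l) l) := by
  have hw := (hu.rotA a b).rotA a b
  have hB (y : E3) (hy : ‖y - l • ω‖ ≤ t + r - l) :=
    hw.abs_initial_le (N := Bfun ρ 2 φ ψ 1 t (r • ω) * (1 + ‖y‖ ^ 2) ^ (-(ρ / 2)))
      (le_Bfun_mul_of_le_snorm hφ hψ ρ 2 (norm_sub_smul_le hω hrl hy)
        (.inl (abs_srot_srot_le_snorm (by norm_num) hab φ y)))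
      (le_Bfun_mul_of_le_snorm hφ hψ ρ 2 (norm_sub_smul_le hω hrl hy)
        (.inr (abs_srot_srot_le_snorm (by norm_num) hab ψ y)))
      fun j => le_Bfun_mul_of_le_snorm hφ hψ ρ 2 (norm_sub_smul_le hω hrl hy)
        (.inl (abs_sd_srot_srot_le_snorm (by norm_num) j hab φ y))
  exact abs_le_sphWeight hw.1 hw.solvesWave hω (hr.trans hrl) (sub_nonneg.2 hl)
    (fun y hy => (hB y hy).1) (fun y hy => (hB y hy).2.1) fun j y hy => (hB y hy).2.2 j

lemma abs_coneFluxDeriv_le {φ ψ : SFn} {u : Fn} (hφ : ContDiff ℝ (⊤ : ℕ∞) φ)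
    (hψ : ContDiff ℝ (⊤ : ℕ∞) ψ) (hu : IsFreeWaveSol 1 φ ψ u) (ρ : ℝ) {t r l : ℝ} {ω : E3}
    (hω : ‖ω‖ = 1) (hr : 0 < r) (hrl : r ≤ l) (hl : l < t + r) :
    |coneFluxDeriv u (t + r) 0 ω l| ≤ 6 * Bfun ρ 2 φ ψ 1 t (r • ω) *
      (1 / l * ((1 + (t + r - l)) * sphWeight ρ (t + r - l) l)) := by
  have hl0 : 0 < l := hr.trans_le hrl
  have h (a b : Fin 3) (hab : a < b) := abs_rotA_rotA_le hφ hψ hu ρ hω hr.le hrl hl.le hab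
  have h3 := abs_add_three (rotA 0 1 (rotA 0 1 u) (t + r - l) (l • ω))
    (rotA 0 2 (rotA 0 2 u) (t + r - l) (l • ω)) (rotA 1 2 (rotA 1 2 u) (t + r - l) (l • ω))
  have hmul : l * |coneFluxDeriv u (t + r) 0 ω l| ≤ 6 * Bfun ρ 2 φ ψ 1 t (r • ω) *
      ((1 + (t + r - l)) * sphWeight ρ (t + r - l) l) := by
    rw [← abs_of_pos hl0, ← abs_mul, abs_of_pos hl0,
      mul_coneFluxDeriv_eq_rotA hu.1 hu.solvesWave hl hω, abs_neg]
    linarith [h 0 1 (by decide), h 0 2 (by decide), h 1 2 (by decide)]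
  calc |coneFluxDeriv u (t + r) 0 ω l| = 1 / l * (l * |coneFluxDeriv u (t + r) 0 ω l|) := by
        field_simp
    _ ≤ 1 / l * (6 * Bfun ρ 2 φ ψ 1 t (r • ω) *
          ((1 + (t + r - l)) * sphWeight ρ (t + r - l) l)) := by gcongr
    _ = _ := by ring

lemma abs_coneFlux_initial_le {φ ψ : SFn} {u : Fn} (hφ : ContDiff ℝ (⊤ : ℕ∞) φ)
    (hψ : ContDiff ℝ (⊤ : ℕ∞) ψ) (hu : IsFreeWaveSol 1 φ ψ u) (ρ : ℝ) {t r : ℝ} {ω : E3}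
    (hω : ‖ω‖ = 1) (ht : 0 ≤ t) (hr : 0 ≤ r) :
    |coneFlux u (t + r) 0 ω (t + r)| ≤
      (1 + 4 * (t + r)) * (Bfun ρ 2 φ ψ 1 t (r • ω) * (1 + (t + r) ^ 2) ^ (-(ρ / 2))) := by
  have hR : 0 ≤ t + r := add_nonneg ht hr
  have hy := norm_sub_smul_le (y := (t + r) • ω) (t := t) hω (le_add_of_nonneg_left ht : r ≤ t + r)
    (by simp)
  have hB := hu.abs_initial_le
    (le_Bfun_mul_of_le_snorm hφ hψ ρ 2 hy (.inl (abs_le_snorm _ φ _)))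
    (le_Bfun_mul_of_le_snorm hφ hψ ρ 2 hy (.inr (abs_le_snorm _ ψ _)))
    fun j => le_Bfun_mul_of_le_snorm hφ hψ ρ 2 hy (.inl (abs_sd_le_snorm (by norm_num) j φ _))
  rw [norm_smul, hω, mul_one, norm_eq_abs, sq_abs] at hB
  refine abs_coneFlux_le hR hω ?_ ?_ ?_ <;> rw [zero_add]
  exacts [hB.1, hB.2.1, hB.2.2]

lemma one_add_mul_bracket_rpow_le {κ μ R : ℝ} (hκ : 0 ≤ κ) (hμ : 0 ≤ μ) (hR : 1 ≤ R) :
    (1 + 4 * R) * (1 + R ^ 2) ^ (-((κ + μ + 1) / 2)) ≤ 5 * R ^ (-κ) := by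
  have hR0 : 0 < R := by linarith
  have h1 : (1 + R ^ 2) ^ (-((κ + μ + 1) / 2)) ≤ R ^ (-(κ + 1)) := by
    calc (1 + R ^ 2) ^ (-((κ + μ + 1) / 2)) ≤ (R ^ 2) ^ (-((κ + μ + 1) / 2)) :=
          rpow_le_rpow_of_nonpos (by positivity) (by linarith) (by linarith)
      _ = R ^ (-(κ + μ + 1)) := by
          rw [← rpow_natCast, ← rpow_mul hR0.le]
          congr 1
          push_cast
          ring
      _ ≤ R ^ (-(κ + 1)) := rpow_le_rpow_of_exponent_le hR (by linarith)
  calc (1 + 4 * R) * (1 + R ^ 2) ^ (-((κ + μ + 1) / 2)) ≤ (5 * R) * R ^ (-(κ + 1)) := by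
        gcongr
        linarith
    _ = 5 * R ^ (-κ) := by
        rw [neg_add, rpow_add hR0, rpow_neg_one]
        field_simp

lemma rpow_neg_le_jb_rpow_neg {κ R : ℝ} (hκ0 : 0 ≤ κ) (hκ2 : κ ≤ 2) (hR : 1 ≤ R) :
    R ^ (-κ) ≤ 4 * jb R ^ (-κ) := by
  have hR0 : 0 < R := by linarith
  have hj : 0 < jb R := sqrt_pos.2 (by positivity)
  have hle : jb R ≤ 2 * R := sqrt_le_iff.2 ⟨by linarith, by nlinarith⟩
  have h := rpow_le_rpow_of_nonpos hj hle (neg_nonpos.2 hκ0)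
  rw [mul_rpow zero_le_two hR0.le] at h
  have h2 : (1 : ℝ) ≤ 4 * 2 ^ (-κ) := by
    have : (2 : ℝ) ^ (-2 : ℝ) ≤ 2 ^ (-κ) := rpow_le_rpow_of_exponent_le one_le_two (by linarith)
    norm_num [rpow_neg] at this ⊢
    linarith
  calc R ^ (-κ) ≤ 4 * 2 ^ (-κ) * R ^ (-κ) := le_mul_of_one_le_left (by positivity) h2
    _ = 4 * (2 ^ (-κ) * R ^ (-κ)) := by ring
    _ ≤ _ := by gcongr

end OutgoingDerivative

theorem stmt16 (κ μ : ℝ) (hκ1 : 1 ≤ κ) (hκ2 : κ ≤ 2) (hμ : 0 < μ) :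
    ∃ C > (0 : ℝ), ∀ (φ ψ : SFn) (u : Fn), ContDiff ℝ (⊤ : ℕ∞) φ → ContDiff ℝ (⊤ : ℕ∞) ψ →
      IsFreeWaveSol 1 φ ψ u →
      ∀ (t r : ℝ) (ω : E3), 0 < t → 1 ≤ r → ‖ω‖ = 1 →
        |deriv (fun s' => Vrad u ω s' r) t + deriv (fun ρ' => Vrad u ω t ρ') r| ≤
          C * jb (t + r) ^ (-κ) * Bfun (κ + μ + 1) 2 φ ψ 1 t (r • ω) := by
  obtain ⟨C, hC, hmaj⟩ := exists_cone_majorant hκ1 hκ2 hμ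
  refine ⟨4 * (5 + 6 * C), by positivity, fun φ ψ u hφ hψ hu t r ω ht hr hω => ?_⟩
  have hr0 : 0 < r := by linarith
  have hrR : r ≤ t + r := by linarith
  have hR : 1 ≤ t + r := by linarith
  obtain ⟨g, hgi, hg, hgint⟩ := hmaj r (t + r) hr hrR
  set B := Bfun (κ + μ + 1) 2 φ ψ 1 t (r • ω)
  have hB : 0 ≤ B := by
    have h := (snorm_nonneg 3 φ (r • ω)).trans (le_Bfun_mul_of_le_snorm hφ hψ (κ + μ + 1) 2
      (x := r • ω) (c := 1) (t := t) (by simpa using ht.le) (.inl le_rfl))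
    exact nonneg_of_mul_nonneg_left h (by positivity)
  have hftc := intervalIntegral.integral_eq_sub_of_hasDerivAt (a := r) (b := t + r)
    (fun s _ => hasDerivAt_coneFlux hu.1 (t + r) 0 ω s)
    ((continuous_coneFluxDeriv hu.1 (t + r) 0 continuous_const
      continuous_id).intervalIntegrable _ _)
  have hbdry : |coneFlux u (t + r) 0 ω (t + r)| ≤ 5 * B * (t + r) ^ (-κ) := by
    refine (abs_coneFlux_initial_le hφ hψ hu (κ + μ + 1) hω ht.le hr0.le).trans ?_
    have h := one_add_mul_bracket_rpow_le (by linarith : 0 ≤ κ) hμ.le hR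
    calc _ = B * ((1 + 4 * (t + r)) * (1 + (t + r) ^ 2) ^ (-((κ + μ + 1) / 2))) := by ring
      _ ≤ B * (5 * (t + r) ^ (-κ)) := by gcongr
      _ = _ := by ring
  have hint : |∫ l in r..t + r, coneFluxDeriv u (t + r) 0 ω l| ≤ 6 * B * (C * (t + r) ^ (-κ)) := by
    have hae : ∀ᵐ l : ℝ, l ∈ Set.Ioc r (t + r) → ‖coneFluxDeriv u (t + r) 0 ω l‖ ≤ 6 * B * g l := by
      filter_upwards [MeasureTheory.Measure.ae_ne MeasureTheory.volume (t + r)] with l hne hl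
      refine (abs_coneFluxDeriv_le hφ hψ hu (κ + μ + 1) hω hr0 hl.1.le
        (lt_of_le_of_ne hl.2 hne)).trans ?_
      gcongr
      exact hg l ⟨hl.1.le, hl.2⟩
    refine (intervalIntegral.norm_integral_le_of_norm_le hrR hae (hgi.const_mul _)).trans ?_
    rw [intervalIntegral.integral_const_mul]
    gcongr
  rw [deriv_Vrad_add_deriv_Vrad hu.1,
    show coneFlux u (t + r) 0 ω r = coneFlux u (t + r) 0 ω (t + r) -
      ∫ l in r..t + r, coneFluxDeriv u (t + r) 0 ω l by rw [hftc]; ring]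
  calc _ ≤ 5 * B * (t + r) ^ (-κ) + 6 * B * (C * (t + r) ^ (-κ)) :=
        (abs_sub _ _).trans (add_le_add hbdry hint)
    _ = (5 + 6 * C) * B * (t + r) ^ (-κ) := by ring
    _ ≤ (5 + 6 * C) * B * (4 * jb (t + r) ^ (-κ)) := by
        gcongr
        exact rpow_neg_le_jb_rpow_neg (by linarith) hκ2 hR
    _ = _ := by ring

end PaperKatayama
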